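/- arXiv:2406.03238 — 2 statements merged into one kernel-verified Lean document; each statement's English description precedes it below -/
import Mathlib

section
/- The comultiplication of the Hall algebra is an algebra homomorphism for the twisted multiplication: for all objects M, N of 𝒜, Δ(u_{[M]} * u_{[N]}) = Δ(u_{[M]}) * Δ(u_{[N]}) in ℋ(𝒜) ⊗ ℋ(𝒜), where the multiplication on ℋ(𝒜) ⊗ ℋ(𝒜) is the twisted one defined by (u_{[M₁]} ⊗ u_{[M₂]}) * (u_{[N₁]} ⊗ u_{[N₂]}) = v^{(M₂,N₁)} (u_{[M₁]} * u_{[N₁]}) ⊗ (u_{[M₂]} * u_{[N₂]}). -/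
/-!
The comultiplication of the Hall algebra of a finitary hereditary 𝔽_q-linear abelian
category is an algebra homomorphism for the twisted multiplication on `ℋ(𝒜) ⊗ ℋ(𝒜)`:
`Δ(u_[M] * u_[N]) = Δ(u_[M]) * Δ(u_[N])`.
Here `ℋ(𝒜) ⊗ ℋ(𝒜)` is realized concretely as the free `ℂ`-module on pairs of
isomorphism classes, with basis `u_[M₁] ⊗ u_[M₂]`.
-/

open CategoryTheory CategoryTheory.Limits

attribute [local instance] Classical.propDecidable

universe v u

namespace HallAlg

variable (C : Type u) [Category.{v} C] [Abelian C]

/-- Ext groups exist (with the standard construction of the derived category). -/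
instance hasExtStandard : HasExt.{max u v} C :=
  letI := HasDerivedCategory.standard C
  hasExt_of_hasDerivedCategory C

/-- Objects are equivalent iff they are isomorphic. -/
def isoSetoid : Setoid C where
  r X Y := Nonempty (X ≅ Y)
  iseqv := ⟨fun X => ⟨Iso.refl X⟩, fun ⟨e⟩ => ⟨e.symm⟩, fun ⟨e⟩ ⟨f⟩ => ⟨e.trans f⟩⟩

/-- The type of isomorphism classes of objects of `C`. -/
def IsoCls : Type u := Quotient (isoSetoid C)

/-- The underlying `ℂ`-vector space of the Hall algebra: the free `ℂ`-module on the
set of isomorphism classes, with basis `u_[M]`. -/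
def Hall : Type u := IsoCls C →₀ ℂ

noncomputable instance : AddCommMonoid (Hall C) := inferInstanceAs (AddCommMonoid (IsoCls C →₀ ℂ))
noncomputable instance : Module ℂ (Hall C) := inferInstanceAs (Module ℂ (IsoCls C →₀ ℂ))

/-- A concrete model for `ℋ(𝒜) ⊗ ℋ(𝒜)`: the free `ℂ`-module on pairs of isomorphism
classes, with basis `u_[M] ⊗ u_[N]`. -/
def Hall2 : Type u := (IsoCls C × IsoCls C) →₀ ℂ

noncomputable instance : AddCommMonoid (Hall2 C) :=
  inferInstanceAs (AddCommMonoid ((IsoCls C × IsoCls C) →₀ ℂ))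
noncomputable instance : Module ℂ (Hall2 C) :=
  inferInstanceAs (Module ℂ ((IsoCls C × IsoCls C) →₀ ℂ))

variable {C}

/-- The isomorphism class of an object. -/
def cls (M : C) : IsoCls C := Quotient.mk (isoSetoid C) M

/-- The basis element `u_[M]` of the Hall algebra. -/
noncomputable def u (M : C) : Hall C := Finsupp.single (cls M) 1

/-- `a_X = |Aut X|`, the number of automorphisms of `X`. -/
noncomputable def aut (X : C) : ℕ := Nat.card (Aut X)

/-- The Hall number `g^L_{MN}`: the number of subobjects `L'` of `L` with
`L' ≅ N` and `L/L' ≅ M`. -/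
noncomputable def hallNum (L M N : C) : ℕ :=
  Nat.card {L' : Subobject L //
    Nonempty ((L' : C) ≅ N) ∧ Nonempty (cokernel L'.arrow ≅ M)}

/-- The Euler form `⟨M,N⟩ = dim_{𝔽_q} Hom(M,N) - dim_{𝔽_q} Ext¹(M,N)`, the dimension
of a finite `𝔽_q`-vector space `W` being computed as `log_q |W|`. -/
noncomputable def euler (q : ℕ) (M N : C) : ℤ :=
  (Nat.log q (Nat.card (M ⟶ N)) : ℤ) -
    (Nat.log q (Nat.card (Abelian.Ext.{max u v} M N 1)) : ℤ)

/-- `u_[M] * u_[N] = v^⟨M,N⟩ ∑_{[L]} g^L_{MN} u_[L]`, for isomorphism classes. -/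
noncomputable def mulBasis (v : ℂ) (q : ℕ) (a b : IsoCls C) : Hall C :=
  ∑ᶠ l : IsoCls C,
    (v ^ euler q a.out b.out * (hallNum l.out a.out b.out : ℂ)) • Finsupp.single l 1

/-- The multiplication of the Hall algebra, extended bilinearly from basis elements. -/
noncomputable def hmul (v : ℂ) (q : ℕ) (f g : Hall C) : Hall C :=
  Finsupp.sum f fun a c => Finsupp.sum g fun b d => (c * d) • mulBasis v q a b

/-- `Δ(u_[L]) = ∑_{[M],[N]} v^⟨M,N⟩ g^L_{MN} a_M a_N a_L⁻¹ u_[M] ⊗ u_[N]`. -/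
noncomputable def deltaBasis (v : ℂ) (q : ℕ) (l : IsoCls C) : Hall2 C :=
  ∑ᶠ mn : IsoCls C × IsoCls C,
    (v ^ euler q mn.1.out mn.2.out *
        (hallNum l.out mn.1.out mn.2.out * aut mn.1.out * aut mn.2.out : ℂ) /
        (aut l.out : ℂ)) • Finsupp.single mn 1

/-- The comultiplication of the Hall algebra, extended linearly from basis elements. -/
noncomputable def delta (v : ℂ) (q : ℕ) (f : Hall C) : Hall2 C :=
  Finsupp.sum f fun l c => c • deltaBasis v q l

/-- `(f ⊗ g) ∈ ℋ(𝒜) ⊗ ℋ(𝒜)` in the concrete model. -/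
noncomputable def combine (f g : Hall C) : Hall2 C :=
  Finsupp.sum f fun a c => Finsupp.sum g fun b d => Finsupp.single (a, b) (c * d)

/-- The twisted multiplication on `ℋ(𝒜) ⊗ ℋ(𝒜)`:
`(u_[M₁] ⊗ u_[M₂]) * (u_[N₁] ⊗ u_[N₂]) =
  v^{(M₂,N₁)} (u_[M₁] * u_[N₁]) ⊗ (u_[M₂] * u_[N₂])`,
where `(M₂,N₁) = ⟨M₂,N₁⟩ + ⟨N₁,M₂⟩` is the symmetrized Euler form. -/
noncomputable def hmul2 (v : ℂ) (q : ℕ) (x y : Hall2 C) : Hall2 C :=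
  Finsupp.sum x fun m c => Finsupp.sum y fun n d =>
    (c * d * (v ^ euler q m.2.out n.1.out * v ^ euler q n.1.out m.2.out)) •
      combine (mulBasis v q m.1 n.1) (mulBasis v q m.2 n.2)

section

open Pretriangulated DerivedCategory in
/-- Every class in `Ext¹` is the class of a short exact sequence. -/
lemma exists_shortExact_extClass_eq {M N : C} (e : Abelian.Ext.{max u v} M N 1) :
    ∃ (E : C) (a : N ⟶ E) (b : E ⟶ M) (w : a ≫ b = 0)
      (h : (ShortComplex.mk a b w).ShortExact), h.extClass = e := by
  let := HasDerivedCategory.standard C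
  obtain ⟨Z, α, β, hT⟩ := distinguished_cocone_triangle₂ (C := DerivedCategory C) e.hom
  have : Z.IsLE 0 := TStructure.t.isLE₂ _ hT 0 (inferInstanceAs (((singleFunctor C 0).obj N).IsLE 0))
    (inferInstanceAs (((singleFunctor C 0).obj M).IsLE 0))
  have : Z.IsGE 0 := TStructure.t.isGE₂ _ hT 0 (inferInstanceAs (((singleFunctor C 0).obj N).IsGE 0))
    (inferInstanceAs (((singleFunctor C 0).obj M).IsGE 0))
  obtain ⟨E, ⟨i⟩⟩ := Z.exists_iso_singleFunctor_obj_of_isGE_of_isLE 0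
  obtain ⟨a, ha⟩ := (singleFunctor C 0).map_surjective (α ≫ i.hom)
  obtain ⟨b, hb⟩ := (singleFunctor C 0).map_surjective (i.inv ≫ β)
  have hT' : Triangle.mk ((singleFunctor C 0).map a) ((singleFunctor C 0).map b) e.hom ∈
      distTriang (DerivedCategory C) := by
    refine isomorphic_distinguished _ hT _ (Triangle.isoMk _ _ (Iso.refl _) i.symm (Iso.refl _)
      ?_ ?_ ?_)
    · change (singleFunctor C 0).map a ≫ i.inv = 𝟙 _ ≫ α
      rw [ha, Category.assoc, i.hom_inv_id, Category.comp_id, Category.id_comp]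
    · change (singleFunctor C 0).map b ≫ 𝟙 _ = i.inv ≫ β
      rw [hb, Category.comp_id]
    · change e.hom ≫ (𝟙 ((singleFunctor C 0).obj N))⟦1⟧' = 𝟙 _ ≫ e.hom
      rw [CategoryTheory.Functor.map_id]
      exact (Category.comp_id _).trans (Category.id_comp _).symm
  have hι : ∀ ⦃X Y : C⦄ ⦃n : ℤ⦄ (f : (singleFunctor C 0).obj X ⟶
      ((singleFunctor C 0).obj Y)⟦n⟧), n < 0 → f = 0 := by
    intro X Y n f hn
    have : TStructure.t.IsLE ((singleFunctor C 0).obj X) 0 :=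
      inferInstanceAs (((singleFunctor C 0).obj X).IsLE 0)
    have : TStructure.t.IsGE ((singleFunctor C 0).obj Y) 0 :=
      inferInstanceAs (((singleFunctor C 0).obj Y).IsGE 0)
    have := TStructure.t.isGE_shift ((singleFunctor C 0).obj Y) 0 n (-n) (by lia)
    exact TStructure.t.zero f 0 (-n) (by lia)
  have hK := Triangulated.AbelianSubcategory.isLimitKernelForkOfDistTriang hι a b _ hT'
  have hQ := Triangulated.AbelianSubcategory.isColimitCokernelCoforkOfDistTriang hι a b _ hT'
  have w : a ≫ b = 0 := (singleFunctor C 0).map_injective (by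
    rw [Functor.map_comp, Functor.map_zero]
    exact comp_distTriang_mor_zero₁₂ _ hT')
  have hab : (ShortComplex.mk a b w).ShortExact :=
    { exact := ShortComplex.exact_of_f_is_kernel _ hK
      mono_f := mono_of_isLimit_fork hK
      epi_g := epi_of_isColimit_cofork hQ }
  refine ⟨E, a, b, w, hab, ?_⟩
  ext
  rw [hab.extClass_hom]
  obtain ⟨c, hc₂, hc₃⟩ := complete_distinguished_triangle_morphism _ _
    hab.singleTriangle_distinguished hT' (𝟙 _) (𝟙 _)
    ((Category.comp_id _).trans (Category.id_comp _).symm)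
  obtain ⟨c, rfl⟩ := (singleFunctor C 0).map_surjective c
  have hbc : b ≫ c = b := (singleFunctor C 0).map_injective (by
    rw [Functor.map_comp]
    exact hc₂.trans (Category.id_comp _))
  have := hab.epi_g
  have hc : c = 𝟙 _ := by
    rw [← cancel_epi b, hbc, Category.comp_id]
  subst hc
  have h₃ : hab.singleδ ≫ (𝟙 ((singleFunctor C 0).obj N))⟦1⟧' =
      (singleFunctor C 0).map (𝟙 M) ≫ e.hom := hc₃
  rw [CategoryTheory.Functor.map_id, CategoryTheory.Functor.map_id] at h₃
  exact (Category.comp_id _).symm.trans (h₃.trans (Category.id_comp _))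

end

section

/-- The morphisms `a : N ⟶ L` and `b : L ⟶ M` form a short exact sequence. -/
structure SES {L M N : C} (a : N ⟶ L) (b : L ⟶ M) : Prop where
  w : a ≫ b = 0
  shortExact : (ShortComplex.mk a b w).ShortExact

namespace SES

variable {L M N : C} {a : N ⟶ L} {b : L ⟶ M}

lemma mono (h : SES a b) : Mono a := h.shortExact.mono_f

lemma epi (h : SES a b) : Epi b := h.shortExact.epi_g

lemma exists_lift (h : SES a b) {T : C} (x : T ⟶ L) (hx : x ≫ b = 0) : ∃ t : T ⟶ N, t ≫ a = x := by
  have := h.mono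
  exact ⟨h.shortExact.exact.lift x hx, h.shortExact.exact.lift_f x hx⟩

lemma exists_desc (h : SES a b) {T : C} (x : L ⟶ T) (hx : a ≫ x = 0) : ∃ t : M ⟶ T, b ≫ t = x := by
  have := h.epi
  exact ⟨h.shortExact.exact.desc x hx, h.shortExact.exact.g_desc x hx⟩

lemma of_lift (hm : Mono a) (he : Epi b) (w : a ≫ b = 0)
    (h : ∀ (T : C) (x : T ⟶ L), x ≫ b = 0 → ∃ t : T ⟶ N, t ≫ a = x) : SES a b :=
  ⟨w, { mono_f := hm, epi_g := he
        exact := ShortComplex.exact_of_f_is_kernel _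
          (KernelFork.IsLimit.ofι' a w fun x hx => ⟨(h _ x hx).choose, (h _ x hx).choose_spec⟩) }⟩

lemma of_desc (hm : Mono a) (he : Epi b) (w : a ≫ b = 0)
    (h : ∀ (T : C) (x : L ⟶ T), a ≫ x = 0 → ∃ t : M ⟶ T, b ≫ t = x) : SES a b :=
  ⟨w, { mono_f := hm, epi_g := he
        exact := ShortComplex.exact_of_g_is_cokernel _
          (CokernelCofork.IsColimit.ofπ' b w fun x hx =>
            ⟨(h _ x hx).choose, (h _ x hx).choose_spec⟩) }⟩

lemma of_mono (a : N ⟶ L) [Mono a] : SES a (cokernel.π a) :=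
  of_desc inferInstance inferInstance (by simp) fun _ x hx => ⟨cokernel.desc a x hx, by simp⟩

lemma of_epi (b : L ⟶ M) [Epi b] : SES (kernel.ι b) b :=
  of_lift inferInstance inferInstance (by simp) fun _ x hx => ⟨kernel.lift b x hx, by simp⟩

lemma comp_iso (h : SES a b) {M' : C} (e : M ≅ M') : SES a (b ≫ e.hom) := by
  have := h.epi
  refine of_lift h.mono inferInstance (by rw [← Category.assoc, h.w, zero_comp]) fun T x hx =>
    h.exists_lift x ?_
  rwa [← Category.assoc, Preadditive.IsIso.comp_right_eq_zero] at hx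

lemma iso_comp (h : SES a b) {N' : C} (e : N' ≅ N) : SES (e.hom ≫ a) b := by
  have := h.mono
  refine of_desc inferInstance h.epi (by rw [Category.assoc, h.w, comp_zero]) fun T x hx =>
    h.exists_desc x ?_
  rwa [Category.assoc, Preadditive.IsIso.comp_left_eq_zero] at hx

lemma comp_middle (h : SES a b) {L' : C} (e : L ≅ L') : SES (a ≫ e.hom) (e.inv ≫ b) := by
  have := h.mono
  have := h.epi
  refine of_lift inferInstance inferInstance (by simp [h.w]) fun T x hx => ?_
  obtain ⟨t, ht⟩ := h.exists_lift (x ≫ e.inv) (by simpa using hx)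
  exact ⟨t, by rw [← Category.assoc, ht]; simp⟩

/-- The class in `Ext¹` of a short exact sequence. -/
noncomputable def cls (h : SES a b) : Abelian.Ext.{max u v} M N 1 := h.shortExact.extClass

open Abelian in
lemma cls_naturality (h : SES a b) {L' M' N' : C} {a' : N' ⟶ L'} {b' : L' ⟶ M'} (h' : SES a' b')
    (f : N ⟶ N') (g : L ⟶ L') (k : M ⟶ M') (hfg : a ≫ g = f ≫ a') (hgk : b ≫ k = g ≫ b') :
    h.cls.comp (Ext.mk₀ f) (add_zero 1) = (Ext.mk₀ k).comp h'.cls (zero_add 1) :=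
  ShortComplex.ShortExact.extClass_naturality h.shortExact h'.shortExact
    { τ₁ := f, τ₂ := g, τ₃ := k, comm₁₂ := hfg.symm, comm₂₃ := hgk.symm }

open Abelian in
lemma exists_extend (h : SES a b) {Y : C} (f : N ⟶ Y)
    (hf : h.cls.comp (Ext.mk₀ f) (add_zero 1) = 0) : ∃ g : L ⟶ Y, a ≫ g = f := by
  obtain ⟨x, hx⟩ := Ext.contravariant_sequence_exact₁ h.shortExact Y (Ext.mk₀ f) (add_zero 1) hf
  obtain ⟨g, rfl⟩ := (Ext.mk₀_bijective _ _).2 x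
  exact ⟨g, (Ext.mk₀_bijective _ _).1 (by rw [← hx]; simp)⟩

open Abelian in
lemma exists_lift_of_comp_cls (h : SES a b) {X : C} (f : X ⟶ M)
    (hf : (Ext.mk₀ f).comp h.cls (zero_add 1) = 0) : ∃ g : X ⟶ L, g ≫ b = f := by
  obtain ⟨x, hx⟩ := Ext.covariant_sequence_exact₃ X h.shortExact (Ext.mk₀ f) (zero_add 1) hf
  obtain ⟨g, rfl⟩ := (Ext.mk₀_bijective _ _).2 x
  exact ⟨g, (Ext.mk₀_bijective _ _).1 (by rw [← hx]; simp)⟩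

open Abelian in
lemma cls_comp_left (h : SES a b) : h.cls.comp (Ext.mk₀ a) (add_zero 1) = 0 :=
  h.shortExact.extClass_comp

open Abelian in
/-- Two extensions with the same class are equivalent. -/
lemma exists_hom_of_cls_eq (h : SES a b) {L' : C} {a' : N ⟶ L'} {b' : L' ⟶ M} (h' : SES a' b')
    (e : h.cls = h'.cls) : ∃ θ : L ⟶ L', a ≫ θ = a' ∧ θ ≫ b' = b := by
  obtain ⟨φ, hφ⟩ := h.exists_extend a' (by rw [e]; exact h'.cls_comp_left)
  obtain ⟨g, hg⟩ := h.exists_desc (φ ≫ b') (by rw [← Category.assoc, hφ, h'.w])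
  have hn := h.cls_naturality h' (𝟙 N) φ g (by simpa using hφ) hg
  rw [e, Ext.comp_mk₀_id] at hn
  obtain ⟨k, hk⟩ := h'.exists_lift_of_comp_cls (𝟙 M - g) (by
    rw [sub_eq_add_neg, Ext.mk₀_add, Ext.add_comp, Ext.mk₀_neg, Ext.neg_comp, ← hn,
      Ext.mk₀_id_comp, add_neg_cancel])
  refine ⟨φ + b ≫ k, ?_, ?_⟩
  · rw [Preadditive.comp_add, ← Category.assoc, h.w, zero_comp, add_zero, hφ]
  · rw [Preadditive.add_comp, Category.assoc, hk, ← hg, Preadditive.comp_sub, Category.comp_id]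
    abel

lemma isIso_of_comp_eq (h : SES a b) {L' : C} {a' : N ⟶ L'} {b' : L' ⟶ M} (h' : SES a' b')
    (θ : L ⟶ L') (h₁ : a ≫ θ = a') (h₂ : θ ≫ b' = b) : IsIso θ := by
  let φ : ShortComplex.mk a b h.w ⟶ ShortComplex.mk a' b' h'.w :=
    { τ₁ := 𝟙 N, τ₂ := θ, τ₃ := 𝟙 M, comm₁₂ := by simp [h₁], comm₂₃ := by simp [h₂] }
  have : IsIso φ.τ₁ := inferInstanceAs (IsIso (𝟙 N))
  have : IsIso φ.τ₃ := inferInstanceAs (IsIso (𝟙 M))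
  exact ShortComplex.isIso₂_of_shortExact_of_isIso₁₃ φ h.shortExact h'.shortExact

/-- The equivalences between two extensions with the same class form a torsor under `Hom(M, N)`. -/
noncomputable def isoEquivHom (h : SES a b) {L' : C} {a' : N ⟶ L'} {b' : L' ⟶ M} (h' : SES a' b')
    (e : h.cls = h'.cls) : (M ⟶ N) ≃ {θ : L ≅ L' // a ≫ θ.hom = a' ∧ θ.inv ≫ b = b'} :=
  have hθ := h.exists_hom_of_cls_eq h' e
  let θ := hθ.choose
  have h₁ : a ≫ θ = a' := hθ.choose_spec.1
  have h₂ : θ ≫ b' = b := hθ.choose_spec.2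
  have k₁ (f : M ⟶ N) : a ≫ (θ + b ≫ f ≫ a') = a' := by
    rw [Preadditive.comp_add, ← Category.assoc a b, h.w, zero_comp, add_zero, h₁]
  have k₂ (f : M ⟶ N) : (θ + b ≫ f ≫ a') ≫ b' = b := by
    rw [Preadditive.add_comp, Category.assoc, Category.assoc, h'.w, comp_zero, comp_zero,
      add_zero, h₂]
  have (f : M ⟶ N) := h.isIso_of_comp_eq h' _ (k₁ f) (k₂ f)
  Equiv.ofBijective (fun f => ⟨asIso (θ + b ≫ f ≫ a'), k₁ f, by
      rw [Iso.inv_comp_eq]; exact (k₂ f).symm⟩) (by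
    have := h'.mono
    have := h.epi
    constructor
    · intro f g hfg
      have := congrArg (fun x => x.1.hom) hfg
      simpa [cancel_mono, cancel_epi] using this
    · rintro ⟨φ, hφ₁, hφ₂⟩
      rw [Iso.inv_comp_eq] at hφ₂
      obtain ⟨g, hg⟩ := h.exists_desc (φ.hom - θ) (by
        rw [Preadditive.comp_sub, hφ₁, h₁, sub_self])
      obtain ⟨f, hf⟩ := h'.exists_lift g (by
        rw [← cancel_epi b, ← Category.assoc, hg, Preadditive.sub_comp, ← hφ₂, h₂, sub_self,
          comp_zero])
      refine ⟨f, Subtype.ext (Iso.ext ?_)⟩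
      change θ + b ≫ f ≫ a' = φ.hom
      rw [hf, hg]
      abel)

end SES

lemma exists_SES_cls_eq {M N : C} (e : Abelian.Ext.{max u v} M N 1) :
    ∃ (E : C) (a : N ⟶ E) (b : E ⟶ M) (h : SES a b), h.cls = e := by
  obtain ⟨E, a, b, w, h, he⟩ := exists_shortExact_extClass_eq e
  exact ⟨E, a, b, ⟨w, h⟩, he⟩

end

section

open scoped ENNReal

/-- The cardinality of a type, as an extended nonnegative real number. -/
noncomputable def cnt (T : Type*) : ℝ≥0∞ := ∑' _ : T, 1

section Cnt

variable {α β : Type*}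

lemma cnt_congr (e : α ≃ β) : cnt α = cnt β := (e.tsum_eq fun _ => (1 : ℝ≥0∞))

lemma cnt_sigma (β : α → Type*) : cnt (Σ a, β a) = ∑' a, cnt (β a) :=
  ENNReal.tsum_sigma fun _ _ => 1

lemma tsum_const_eq_cnt_mul (c : ℝ≥0∞) : ∑' _ : α, c = cnt α * c := by
  rw [cnt, ← ENNReal.tsum_mul_right, one_mul]

lemma cnt_prod : cnt (α × β) = cnt α * cnt β := by
  rw [← cnt_congr (Equiv.sigmaEquivProd α β), cnt_sigma]
  exact tsum_const_eq_cnt_mul _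

lemma cnt_eq_card [Finite α] : cnt α = (Nat.card α : ℝ≥0∞) := by
  have := Fintype.ofFinite α
  simp [cnt, tsum_fintype]

lemma cnt_ne_top [Finite α] : cnt α ≠ ∞ := by
  rw [cnt_eq_card]; exact ENNReal.natCast_ne_top _

lemma cnt_ne_zero [Nonempty α] : cnt α ≠ 0 := fun h =>
  one_ne_zero (ENNReal.tsum_eq_zero.1 h (Classical.arbitrary α))

lemma cnt_of_isEmpty [IsEmpty α] : cnt α = 0 := by simp [cnt]

lemma cnt_fiber (f : α → β) : cnt α = ∑' b, cnt {a // f a = b} := by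
  rw [← cnt_sigma, cnt_congr (Equiv.sigmaFiberEquiv f)]

lemma tsum_fiber (f : α → β) (G : β → ℝ≥0∞) :
    ∑' a, G (f a) = ∑' b, G b * cnt {a // f a = b} := by
  rw [← (Equiv.sigmaFiberEquiv f).tsum_eq, ENNReal.tsum_sigma']
  refine tsum_congr fun b => ?_
  rw [cnt, ← ENNReal.tsum_mul_left]
  refine tsum_congr fun a => ?_
  simp [Equiv.sigmaFiberEquiv, a.2]

end Cnt

/-- The inverse of the number of automorphisms of an isomorphism class. -/
noncomputable def wt (S : IsoCls C) : ℝ≥0∞ := (cnt (S.out ≅ S.out))⁻¹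

lemma nonempty_iso_out (X : C) : Nonempty (X ≅ (cls X).out) :=
  (Quotient.exact (Quotient.out_eq (cls X))).map Iso.symm

lemma cls_eq_of_iso {X : C} {S : IsoCls C} (e : X ≅ S.out) : cls X = S :=
  (Quotient.sound (s := isoSetoid C) ⟨e⟩).trans (Quotient.out_eq S)

/-- Composition with an isomorphism on the left. -/
def isoCompEquiv {X Y : C} (e : X ≅ Y) (Z : C) : (X ≅ Z) ≃ (Y ≅ Z) where
  toFun f := e.symm ≪≫ f
  invFun f := e ≪≫ f
  left_inv f := by simp
  right_inv f := by simp

variable [∀ X Y : C, Finite (X ⟶ Y)]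

instance (X Y : C) : Finite (X ≅ Y) :=
  Finite.of_injective (fun e : X ≅ Y => e.hom) fun _ _ h => Iso.ext h

instance (X : C) : Nonempty (X ≅ X) := ⟨Iso.refl X⟩

lemma wt_mul_cnt (S : IsoCls C) : wt S * cnt (S.out ≅ S.out) = 1 :=
  ENNReal.inv_mul_cancel cnt_ne_zero cnt_ne_top

/-- Summing over all isomorphism classes the weighted number of isomorphisms to `X` yields `1`. -/
lemma tsum_wt_mul_cnt (X : C) : ∑' S : IsoCls C, wt S * cnt (X ≅ S.out) = 1 := by
  rw [tsum_eq_single (cls X)]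
  · obtain ⟨e⟩ := nonempty_iso_out X
    rw [cnt_congr (isoCompEquiv e _), wt_mul_cnt]
  · intro S hS
    have : IsEmpty (X ≅ S.out) := ⟨fun e => hS (cls_eq_of_iso e).symm⟩
    rw [cnt_of_isEmpty, mul_zero]

lemma tsum_wt_mul_cnt_of_equiv (X : C) {T : IsoCls C → Type*} (e : ∀ S, T S ≃ (X ≅ S.out)) :
    ∑' S : IsoCls C, wt S * cnt (T S) = 1 := by
  simp_rw [fun S => cnt_congr (e S), tsum_wt_mul_cnt]

/-- The short exact sequences `0 ⟶ N ⟶ L ⟶ M ⟶ 0`. -/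
def P (L M N : C) : Type v := {p : (N ⟶ L) × (L ⟶ M) // SES p.1 p.2}

instance (L M N : C) : Finite (P L M N) := Subtype.finite

/-- The class in `Ext¹` of an element of `P L M N`. -/
noncomputable def P.cls {L M N : C} (p : P L M N) : Abelian.Ext.{max u v} M N 1 := p.2.cls

lemma SES.cls_comp_middle {L M N : C} {a : N ⟶ L} {b : L ⟶ M} (h : SES a b) {L' : C}
    (θ : L ≅ L') : (h.comp_middle θ).cls = h.cls := by
  have := h.cls_naturality (h.comp_middle θ) (𝟙 N) θ.hom (𝟙 M) (by simp) (by simp)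
  rw [Abelian.Ext.comp_mk₀_id, Abelian.Ext.mk₀_id_comp] at this
  exact this.symm

/-- Isomorphisms from the middle term of an extension are counted by the short exact sequences
of the same class. -/
lemma cnt_iso_eq {L M N : C} {a : N ⟶ L} {b : L ⟶ M} (h : SES a b) (L' : C) :
    cnt (L ≅ L') = cnt {p : P L' M N // p.cls = h.cls} * cnt (M ⟶ N) := by
  let f (θ : L ≅ L') : {p : P L' M N // p.cls = h.cls} :=
    ⟨⟨(a ≫ θ.hom, θ.inv ≫ b), h.comp_middle θ⟩, h.cls_comp_middle θ⟩
  rw [cnt_fiber f, cnt, ← ENNReal.tsum_mul_right]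
  refine tsum_congr fun p => ?_
  rw [one_mul, cnt_congr (h.isoEquivHom p.1.2 p.2.symm)]
  refine cnt_congr (Equiv.subtypeEquivRight fun θ => ?_)
  exact ⟨fun k => ⟨congrArg (fun x => x.1.1.1) k, congrArg (fun x => x.1.1.2) k⟩,
    fun k => Subtype.ext (Subtype.ext (Prod.ext k.1 k.2))⟩

lemma tsum_wt_mul_cnt_cls {M N : C} (e : Abelian.Ext.{max u v} M N 1) :
    ∑' E : IsoCls C, wt E * cnt {p : P E.out M N // p.cls = e} = (cnt (M ⟶ N))⁻¹ := by
  obtain ⟨E, a, b, h, rfl⟩ := exists_SES_cls_eq e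
  refine ENNReal.eq_inv_of_mul_eq_one_left ?_
  rw [← ENNReal.tsum_mul_right, ← tsum_wt_mul_cnt E]
  exact tsum_congr fun S => by rw [cnt_iso_eq h, mul_assoc]

lemma tsum_wt_mul_tsum_cls {M N : C} (G : Abelian.Ext.{max u v} M N 1 → ℝ≥0∞) :
    ∑' E : IsoCls C, wt E * ∑' p : P E.out M N, G p.cls = (cnt (M ⟶ N))⁻¹ * ∑' e, G e := by
  simp_rw [fun E : IsoCls C => tsum_fiber (fun p : P E.out M N => p.cls) G,
    ← ENNReal.tsum_mul_left]
  rw [ENNReal.tsum_comm]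
  refine tsum_congr fun e => ?_
  rw [← tsum_wt_mul_cnt_cls e, ← ENNReal.tsum_mul_right]
  exact tsum_congr fun E => by ring

/-- The cokernels of a monomorphism are parametrized by isomorphisms. -/
noncomputable def SES.cokernelEquiv {L M N : C} {a : N ⟶ L} {b : L ⟶ M} (h : SES a b) (M' : C) :
    {b' : L ⟶ M' // SES a b'} ≃ (M ≅ M') :=
  Equiv.symm <| Equiv.ofBijective (fun e => ⟨b ≫ e.hom, h.comp_iso e⟩) (by
    have := h.epi
    constructor
    · intro e e' hh
      have := congrArg Subtype.val hh
      exact Iso.ext (by simpa [cancel_epi] using this)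
    · rintro ⟨b', h'⟩
      have := h'.epi
      obtain ⟨t, ht⟩ := h.exists_desc b' h'.w
      obtain ⟨t', ht'⟩ := h'.exists_desc b h.w
      exact ⟨⟨t, t', by rw [← cancel_epi b, reassoc_of% ht, ht', Category.comp_id],
        by rw [← cancel_epi b', reassoc_of% ht', ht, Category.comp_id]⟩, Subtype.ext ht⟩)

/-- The kernels of an epimorphism are parametrized by isomorphisms. -/
noncomputable def SES.kernelEquiv {L M N : C} {a : N ⟶ L} {b : L ⟶ M} (h : SES a b) (N' : C) :
    {a' : N' ⟶ L // SES a' b} ≃ (N ≅ N') :=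
  Equiv.symm <| Equiv.ofBijective (fun e => ⟨e.inv ≫ a, h.iso_comp e.symm⟩) (by
    have := h.mono
    constructor
    · intro e e' hh
      have := congrArg Subtype.val hh
      exact Iso.ext_inv (by simpa [cancel_mono] using this)
    · rintro ⟨a', h'⟩
      have := h'.mono
      obtain ⟨t, ht⟩ := h.exists_lift a' h'.w
      obtain ⟨t', ht'⟩ := h'.exists_lift a h.w
      exact ⟨⟨t', t, by rw [← cancel_mono a, Category.assoc, ht, ht', Category.id_comp],
        by rw [← cancel_mono a', Category.assoc, ht', ht, Category.id_comp]⟩, Subtype.ext ht⟩)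

/-- A short exact sequence and a quotient of its kernel induce a short exact sequence. -/
lemma exists_SES_cokernel {S E A N B M : C} {s : S ⟶ E} {p : E ⟶ A} (h : SES s p)
    {n : N ⟶ S} {π : S ⟶ B} (hn : SES n π) {b : E ⟶ M} (hb : SES (n ≫ s) b) :
    ∃ (s' : B ⟶ M) (p' : M ⟶ A) (h' : SES s' p'),
      h'.cls = h.cls.comp (Abelian.Ext.mk₀ π) (add_zero 1) := by
  obtain ⟨s', hs'⟩ := hn.exists_desc (s ≫ b) (by rw [← Category.assoc, hb.w])
  obtain ⟨p', hp'⟩ := hb.exists_desc p (by rw [Category.assoc, h.w, comp_zero])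
  have := h.epi
  have := h.mono
  have := hn.epi
  have := hb.epi
  have hmono : Mono s' := by
    rw [Preadditive.mono_iff_cancel_zero]
    intro T x hx
    obtain ⟨T', q, _, y, hy⟩ := surjective_up_to_refinements_of_epi π x
    obtain ⟨t, ht⟩ := hb.exists_lift (y ≫ s) (by
      rw [Category.assoc, ← hs', ← reassoc_of% hy, hx, comp_zero])
    rw [← Category.assoc, cancel_mono] at ht
    rw [← cancel_epi q, hy, ← ht, Category.assoc, hn.w, comp_zero, comp_zero]
  have h' : SES s' p' := by
    refine SES.of_desc hmono (epi_of_epi_fac hp') ?_ fun T x hx => ?_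
    · rw [← cancel_epi π, reassoc_of% hs', hp', h.w, comp_zero]
    · obtain ⟨z, hz⟩ := h.exists_desc (b ≫ x) (by rw [← reassoc_of% hs', hx, comp_zero])
      exact ⟨z, by rw [← cancel_epi b, reassoc_of% hp', hz]⟩
  refine ⟨s', p', h', ?_⟩
  rw [h.cls_naturality h' π b (𝟙 A) hs'.symm (by simpa using hp'.symm), Abelian.Ext.mk₀_id_comp]

lemma cnt_SES_comp {S E A N B : C} {s : S ⟶ E} {p : E ⟶ A} (h : SES s p)
    {n : N ⟶ S} {π : S ⟶ B} (hn : SES n π) (M : C) :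
    cnt {b : E ⟶ M // SES (n ≫ s) b} =
      cnt {q : P M A B // q.cls = h.cls.comp (Abelian.Ext.mk₀ π) (add_zero 1)} * cnt (A ⟶ B) := by
  have := h.mono
  have := hn.mono
  have hb := SES.of_mono (n ≫ s)
  obtain ⟨s', p', h', e⟩ := exists_SES_cokernel h hn hb
  rw [cnt_congr (hb.cokernelEquiv M), cnt_iso_eq h', e]

end

section

open scoped ENNReal

section Groups

variable {A₁ A₂ A₃ A₄ A₅ A₆ : Type*} [AddCommGroup A₁] [AddCommGroup A₂] [AddCommGroup A₃]
  [AddCommGroup A₄] [AddCommGroup A₅] [AddCommGroup A₆]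

lemma card_ker_mul_card_range (f : A₁ →+ A₂) :
    Nat.card f.ker * Nat.card f.range = Nat.card A₁ := by
  rw [← AddSubgroup.index_ker, AddSubgroup.card_mul_index]

lemma card_six_term (f₁ : A₁ →+ A₂) (f₂ : A₂ →+ A₃) (f₃ : A₃ →+ A₄) (f₄ : A₄ →+ A₅)
    (f₅ : A₅ →+ A₆) (h₁ : Function.Injective f₁) (h₂ : f₂.ker = f₁.range)
    (h₃ : f₃.ker = f₂.range) (h₄ : f₄.ker = f₃.range) (h₅ : f₅.ker = f₄.range)
    (h₆ : Function.Surjective f₅) :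
    Nat.card A₁ * Nat.card A₃ * Nat.card A₅ = Nat.card A₂ * Nat.card A₄ * Nat.card A₆ := by
  have e₁ := card_ker_mul_card_range f₁
  have e₂ := card_ker_mul_card_range f₂
  have e₃ := card_ker_mul_card_range f₃
  have e₄ := card_ker_mul_card_range f₄
  have e₅ := card_ker_mul_card_range f₅
  rw [(AddMonoidHom.ker_eq_bot_iff f₁).2 h₁, AddSubgroup.card_bot, one_mul] at e₁
  rw [AddMonoidHom.range_eq_top.2 h₆, AddSubgroup.card_top] at e₅
  rw [h₂] at e₂
  rw [h₃] at e₃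
  rw [h₄] at e₄
  rw [h₅] at e₅
  rw [← e₁, ← e₂, ← e₃, ← e₄, ← e₅]
  ring

lemma cnt_fiber_mul [Finite A₁] (f : A₁ →+ A₂) (hf : Function.Surjective f) (b : A₂) :
    cnt {a // f a = b} * cnt A₂ = cnt A₁ := by
  obtain ⟨a, rfl⟩ := hf b
  let e : f.ker ≃ {x // f x = f a} :=
    { toFun x := ⟨x + a, by rw [map_add, x.2, zero_add]⟩
      invFun x := ⟨x - a, by rw [AddMonoidHom.mem_ker, map_sub, x.2, sub_self]⟩
      left_inv x := by simp
      right_inv x := by simp }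
  have := Finite.of_surjective f hf
  rw [← cnt_congr e, cnt_eq_card, cnt_eq_card, cnt_eq_card, ← card_ker_mul_card_range f,
    AddMonoidHom.range_eq_top.2 hf, AddSubgroup.card_top, Nat.cast_mul]

end Groups

open Abelian

lemma card_ext_zero (X Y : C) : Nat.card (Ext.{max u v} X Y 0) = Nat.card (X ⟶ Y) :=
  Nat.card_congr Ext.homEquiv₀

lemma SES.card_covariant (hhered : ∀ X Y : C, Subsingleton (Ext.{max u v} X Y 2))
    {L M N : C} {a : N ⟶ L} {b : L ⟶ M} (h : SES a b) (T : C) :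
    Nat.card (T ⟶ N) * Nat.card (T ⟶ M) * Nat.card (Ext.{max u v} T L 1) =
      Nat.card (T ⟶ L) * Nat.card (Ext.{max u v} T N 1) * Nat.card (Ext.{max u v} T M 1) := by
  have := h.mono
  have hS := h.shortExact
  simp only [← card_ext_zero]
  refine card_six_term ((Ext.mk₀ a).postcomp T (add_zero 0)) ((Ext.mk₀ b).postcomp T (add_zero 0))
    (h.cls.postcomp T (zero_add 1)) ((Ext.mk₀ a).postcomp T (add_zero 1))
    ((Ext.mk₀ b).postcomp T (add_zero 1)) (Ext.postcomp_mk₀_injective_of_mono T a) ?_ ?_ ?_ ?_ ?_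
  · exact (ShortComplex.ab_exact_iff_range_eq_ker.1 (Ext.covariant_sequence_exact₂' T hS 0)).symm
  · exact (ShortComplex.ab_exact_iff_range_eq_ker.1
      (Ext.covariant_sequence_exact₃' T hS 0 1 (zero_add 1))).symm
  · exact (ShortComplex.ab_exact_iff_range_eq_ker.1
      (Ext.covariant_sequence_exact₁' T hS 0 1 (zero_add 1))).symm
  · exact (ShortComplex.ab_exact_iff_range_eq_ker.1 (Ext.covariant_sequence_exact₂' T hS 1)).symm
  · intro x
    exact Ext.covariant_sequence_exact₃ T hS x rfl (Subsingleton.elim _ _)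

lemma SES.card_contravariant (hhered : ∀ X Y : C, Subsingleton (Ext.{max u v} X Y 2))
    {L M N : C} {a : N ⟶ L} {b : L ⟶ M} (h : SES a b) (T : C) :
    Nat.card (M ⟶ T) * Nat.card (N ⟶ T) * Nat.card (Ext.{max u v} L T 1) =
      Nat.card (L ⟶ T) * Nat.card (Ext.{max u v} M T 1) * Nat.card (Ext.{max u v} N T 1) := by
  have := h.epi
  have hS := h.shortExact
  simp only [← card_ext_zero]
  refine card_six_term ((Ext.mk₀ b).precomp T (zero_add 0)) ((Ext.mk₀ a).precomp T (zero_add 0))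
    (h.cls.precomp T (add_zero 1)) ((Ext.mk₀ b).precomp T (zero_add 1))
    ((Ext.mk₀ a).precomp T (zero_add 1)) (Ext.precomp_mk₀_injective_of_epi T b) ?_ ?_ ?_ ?_ ?_
  · exact (ShortComplex.ab_exact_iff_range_eq_ker.1 (Ext.contravariant_sequence_exact₂' hS T 0)).symm
  · exact (ShortComplex.ab_exact_iff_range_eq_ker.1
      (Ext.contravariant_sequence_exact₁' hS T 0 1 (add_zero 1))).symm
  · exact (ShortComplex.ab_exact_iff_range_eq_ker.1
      (Ext.contravariant_sequence_exact₃' hS T 0 1 (add_zero 1))).symm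
  · exact (ShortComplex.ab_exact_iff_range_eq_ker.1 (Ext.contravariant_sequence_exact₂' hS T 1)).symm
  · intro x
    exact Ext.contravariant_sequence_exact₁ hS T x rfl (Subsingleton.elim _ _)

/-- The number of extensions with prescribed images under an epimorphism onto a biproduct. -/
lemma cnt_ext_fiber_mul (hhered : ∀ X Y : C, Subsingleton (Ext.{max u v} X Y 2))
    [∀ X Y : C, Finite (Ext.{max u v} X Y 1)] {D S B B' : C} {d : D ⟶ S} {f : S ⟶ B} {f' : S ⟶ B'} (h : SES d (biprod.lift f f')) (A : C)
    (x : Ext.{max u v} A B 1) (x' : Ext.{max u v} A B' 1) :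
    cnt {e : Ext.{max u v} A S 1 // e.comp (Ext.mk₀ f) (add_zero 1) = x ∧
        e.comp (Ext.mk₀ f') (add_zero 1) = x'} * cnt (Ext.{max u v} A (B ⊞ B') 1) =
      cnt (Ext.{max u v} A S 1) := by
  have hsurj : Function.Surjective ((Ext.mk₀ (biprod.lift f f')).postcomp A (add_zero 1)) :=
    fun x => Ext.covariant_sequence_exact₃ A h.shortExact x rfl (Subsingleton.elim _ _)
  rw [← cnt_fiber_mul _ hsurj (Ext.addEquivBiprod.symm (x, x'))]
  congr 1
  refine cnt_congr (Equiv.subtypeEquivRight fun e => ?_)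
  rw [AddEquiv.eq_symm_apply]
  simp [Ext.addEquivBiprod, Prod.ext_iff]

end

section

open scoped ENNReal
open Abelian

variable [∀ X Y : C, Finite (X ⟶ Y)] [∀ X Y : C, Finite (Ext.{max u v} X Y 1)]

lemma cnt_hom_biprod (A B B' : C) : cnt (A ⟶ B ⊞ B') = cnt (A ⟶ B) * cnt (A ⟶ B') := by
  rw [← cnt_prod]
  exact cnt_congr
    { toFun f := (f ≫ biprod.fst, f ≫ biprod.snd)
      invFun g := biprod.lift g.1 g.2
      left_inv f := by ext <;> simp
      right_inv g := by simp }

/-- Extensions of `A` by `S`, together with cokernels of the induced subobjects `N` and `Y`. -/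
lemma tsum_wt_mul_tsum_cokernels (hhered : ∀ X Y : C, Subsingleton (Ext.{max u v} X Y 2))
    {N S B Y B' D : C} {n : N ⟶ S} {π : S ⟶ B} {y : Y ⟶ S} {π' : S ⟶ B'} {d : D ⟶ S}
    (hn : SES n π) (hy : SES y π') (hd : SES d (biprod.lift π π')) (A M X : C) :
    ∑' E : IsoCls C, wt E * ∑' p : P E.out A S,
        cnt {b : E.out ⟶ M // SES (n ≫ p.1.1) b} * cnt {b : E.out ⟶ X // SES (y ≫ p.1.1) b} =
      cnt (Ext.{max u v} A D 1) * (cnt (A ⟶ D))⁻¹ * (cnt (P M A B) * cnt (P X A B')) := by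
  let F (e : Ext.{max u v} A S 1) : ℝ≥0∞ :=
    cnt {q : P M A B // q.cls = e.comp (Ext.mk₀ π) (add_zero 1)} *
      cnt {q : P X A B' // q.cls = e.comp (Ext.mk₀ π') (add_zero 1)}
  have h₁ (E : IsoCls C) (p : P E.out A S) : cnt {b : E.out ⟶ M // SES (n ≫ p.1.1) b} *
      cnt {b : E.out ⟶ X // SES (y ≫ p.1.1) b} = F p.cls * (cnt (A ⟶ B) * cnt (A ⟶ B')) := by
    rw [cnt_SES_comp p.2 hn M, cnt_SES_comp p.2 hy X]
    simp only [F, P.cls]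
    ring
  have h₂ : (∑' e, F e) * cnt (Ext.{max u v} A (B ⊞ B') 1) =
      cnt (P M A B) * cnt (P X A B') * cnt (Ext.{max u v} A S 1) := by
    have : ∑' e, F e = ∑' q : P M A B × P X A B', cnt {e : Ext.{max u v} A S 1 //
        e.comp (Ext.mk₀ π) (add_zero 1) = q.1.cls ∧
          e.comp (Ext.mk₀ π') (add_zero 1) = q.2.cls} := by
      simp only [F, ← cnt_prod]
      rw [← cnt_sigma, ← cnt_sigma]
      exact cnt_congr
        { toFun z := ⟨(z.2.1.1, z.2.2.1), z.1, z.2.1.2.symm, z.2.2.2.symm⟩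
          invFun z := ⟨z.2.1, ⟨z.1.1, z.2.2.1.symm⟩, ⟨z.1.2, z.2.2.2.symm⟩⟩
          left_inv _ := rfl
          right_inv _ := rfl }
    rw [this, ← ENNReal.tsum_mul_right, ← cnt_prod]
    simp_rw [cnt_ext_fiber_mul hhered hd A]
    exact tsum_const_eq_cnt_mul _
  have h₃ : cnt (A ⟶ D) * (cnt (A ⟶ B) * cnt (A ⟶ B')) * cnt (Ext.{max u v} A S 1) =
      cnt (A ⟶ S) * cnt (Ext.{max u v} A D 1) * cnt (Ext.{max u v} A (B ⊞ B') 1) := by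
    rw [← cnt_hom_biprod]
    simp only [cnt_eq_card]
    exact_mod_cast hd.card_covariant hhered A
  rw [tsum_congr fun E => congrArg (wt E * ·) (tsum_congr (h₁ E)),
    tsum_wt_mul_tsum_cls fun e => F e * (cnt (A ⟶ B) * cnt (A ⟶ B')), ENNReal.tsum_mul_right]
  have hS : cnt (A ⟶ S) * (cnt (A ⟶ S))⁻¹ = 1 := ENNReal.mul_inv_cancel cnt_ne_zero cnt_ne_top
  have hD : cnt (A ⟶ D) * (cnt (A ⟶ D))⁻¹ = 1 := ENNReal.mul_inv_cancel cnt_ne_zero cnt_ne_top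
  rw [← ENNReal.mul_left_inj (c := cnt (A ⟶ S) * cnt (A ⟶ D) * cnt (Ext.{max u v} A (B ⊞ B') 1))
    (mul_ne_zero (mul_ne_zero cnt_ne_zero cnt_ne_zero) cnt_ne_zero)
    (ENNReal.mul_ne_top (ENNReal.mul_ne_top cnt_ne_top cnt_ne_top) cnt_ne_top)]
  calc _ = (cnt (A ⟶ S) * (cnt (A ⟶ S))⁻¹) * ((∑' e, F e) * cnt (Ext.{max u v} A (B ⊞ B') 1)) *
        (cnt (A ⟶ D) * (cnt (A ⟶ B) * cnt (A ⟶ B'))) := by ring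
    _ = cnt (P M A B) * cnt (P X A B') * (cnt (A ⟶ S) * cnt (Ext.{max u v} A D 1) *
        cnt (Ext.{max u v} A (B ⊞ B') 1)) * (cnt (A ⟶ D) * (cnt (A ⟶ D))⁻¹) := by
      rw [hS, hD, h₂, ← h₃]; ring
    _ = _ := by ring

end

section

open scoped ENNReal

section Pushout

variable {N Y B K D S : C}

lemma SES.pushout_right {d₁ : D ⟶ N} {d₂ : D ⟶ Y} {c₂ : Y ⟶ B} {n : N ⟶ S} {y : Y ⟶ S}
    {π : S ⟶ B} (h₂ : SES d₂ c₂) (hp : IsPushout d₁ d₂ n y) (hn : n ≫ π = 0) (hy : y ≫ π = c₂) :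
    SES n π := by
  have := h₂.mono
  have := h₂.epi
  refine SES.of_desc (Abelian.mono_inl_of_isColimit _ _ hp.isColimit) (epi_of_epi_fac hy) hn
    fun T x hx => ?_
  obtain ⟨z, hz⟩ := h₂.exists_desc (y ≫ x) (by rw [← hp.w_assoc, hx, comp_zero])
  exact ⟨z, hp.hom_ext (by rw [reassoc_of% hn, zero_comp, hx]) (by rw [reassoc_of% hy, hz])⟩

lemma SES.pushout_diagonal {d₁ : D ⟶ N} {d₂ : D ⟶ Y} {c₁ : N ⟶ K} {c₂ : Y ⟶ B} {n : N ⟶ S}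
    {y : Y ⟶ S} {π : S ⟶ B} {π' : S ⟶ K} (h₁ : SES d₁ c₁) (h₂ : SES d₂ c₂)
    (hp : IsPushout d₁ d₂ n y) (hn : n ≫ π = 0) (hy : y ≫ π = c₂) (hn' : n ≫ π' = c₁)
    (hy' : y ≫ π' = 0) : SES (d₁ ≫ n) (biprod.lift π π') := by
  have := h₁.epi
  have := h₂.epi
  have := h₁.mono
  have := (h₂.pushout_right hp hn hy).mono
  have e₁ : n ≫ biprod.lift π π' = c₁ ≫ biprod.inr := by ext <;> simp [hn, hn']
  have e₂ : y ≫ biprod.lift π π' = c₂ ≫ biprod.inl := by ext <;> simp [hy, hy']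
  refine SES.of_desc inferInstance ?_ ?_ fun T x hx => ?_
  · rw [Preadditive.epi_iff_cancel_zero]
    intro T h hh
    ext
    · rw [← cancel_epi c₂, ← reassoc_of% e₂, hh, comp_zero, comp_zero, comp_zero]
    · rw [← cancel_epi c₁, ← reassoc_of% e₁, hh, comp_zero, comp_zero, comp_zero]
  · rw [Category.assoc, e₁, ← Category.assoc, h₁.w, zero_comp]
  · obtain ⟨z, hz⟩ := h₁.exists_desc (n ≫ x) (by rw [← Category.assoc, hx])
    obtain ⟨z', hz'⟩ := h₂.exists_desc (y ≫ x) (by rw [← hp.w_assoc, ← Category.assoc, hx])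
    refine ⟨biprod.desc z' z, hp.hom_ext ?_ ?_⟩
    · rw [reassoc_of% e₁, biprod.inr_desc, hz]
    · rw [reassoc_of% e₂, biprod.inl_desc, hz']

lemma SES.lift_diagonal {n : N ⟶ S} {π : S ⟶ B} {π' : S ⟶ K} {d : D ⟶ S} {d₁ : D ⟶ N}
    (hn : SES n π) (hd : SES d (biprod.lift π π')) (e : d₁ ≫ n = d) : SES d₁ (n ≫ π') := by
  have := hn.mono
  have := hd.mono
  have := hd.epi
  have hw : d ≫ π' = 0 := by simpa using hd.w =≫ biprod.snd
  refine SES.of_lift (mono_of_mono_fac e) ?_ (by rw [reassoc_of% e, hw]) fun T x hx => ?_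
  · rw [Preadditive.epi_iff_cancel_zero]
    intro T x hx
    obtain ⟨z, hz⟩ := hn.exists_desc (π' ≫ x) (by rw [← Category.assoc, hx])
    have : biprod.desc (-z) x = 0 := by
      rw [← cancel_epi (biprod.lift π π'), biprod.lift_desc, Preadditive.comp_neg, hz]
      simp
    simpa using biprod.inr ≫= this
  · obtain ⟨t, ht⟩ := hd.exists_lift (x ≫ n) (by
      ext
      · simp [hn.w]
      · simpa using hx)
    exact ⟨t, by rw [← cancel_mono n, Category.assoc, e, ht]⟩

lemma SES.swap_biprod {π : S ⟶ B} {π' : S ⟶ K} {d : D ⟶ S} (hd : SES d (biprod.lift π π')) :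
    SES d (biprod.lift π' π) := by
  have := hd.comp_iso (biprod.braiding B K)
  convert this using 1
  ext <;> simp

lemma SES.isPushout_diagonal {n : N ⟶ S} {π : S ⟶ B} {y : Y ⟶ S} {π' : S ⟶ K} {d : D ⟶ S}
    {d₁ : D ⟶ N} {d₂ : D ⟶ Y} (hn : SES n π) (hy : SES y π') (hd : SES d (biprod.lift π π'))
    (e₁ : d₁ ≫ n = d) (e₂ : d₂ ≫ y = d) : IsPushout d₁ d₂ n y := by
  have h₂ := hy.lift_diagonal hd.swap_biprod e₂
  have hp := IsPushout.of_hasPushout d₁ d₂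
  have w : d₁ ≫ n = d₂ ≫ y := e₁.trans e₂.symm
  have w' : d₁ ≫ (0 : N ⟶ B) = d₂ ≫ y ≫ π := by rw [h₂.w, comp_zero]
  have h := h₂.pushout_right hp (pushout.inl_desc _ _ w') (pushout.inr_desc _ _ w')
  have : IsIso (pushout.desc n y w) := h.isIso_of_comp_eq hn _ (pushout.inl_desc _ _ w)
    (pushout.hom_ext (by rw [pushout.inl_desc_assoc, pushout.inl_desc, hn.w])
      (by rw [pushout.inr_desc_assoc, pushout.inr_desc]))
  exact IsPushout.of_iso_pushout ⟨w⟩ (asIso (pushout.desc n y w)).symm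
    ((Iso.comp_inv_eq _).2 (pushout.inl_desc _ _ w).symm)
    ((Iso.comp_inv_eq _).2 (pushout.inr_desc _ _ w).symm)

/-- Pushout squares with a given corner are parametrized by isomorphisms. -/
noncomputable def pushoutEquiv (d₁ : D ⟶ N) (d₂ : D ⟶ Y) (S : C) :
    {t : (N ⟶ S) × (Y ⟶ S) // IsPushout d₁ d₂ t.1 t.2} ≃ (pushout d₁ d₂ ≅ S) where
  toFun t := t.2.isoPushout.symm
  invFun e := ⟨(pushout.inl d₁ d₂ ≫ e.hom, pushout.inr d₁ d₂ ≫ e.hom),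
    IsPushout.of_iso_pushout ⟨by rw [pushout.condition_assoc]⟩ e.symm (by simp) (by simp)⟩
  left_inv t := by
    refine Subtype.ext (Prod.ext ?_ ?_)
    · exact t.2.inl_isoPushout_inv
    · exact t.2.inr_isoPushout_inv
  right_inv e := by
    refine Iso.ext (pushout.hom_ext ?_ ?_)
    · exact IsPushout.inl_isoPushout_inv _
    · exact IsPushout.inr_isoPushout_inv _

variable (N Y B K D) in
/-- Two subobjects `N` and `Y` of `S` spanning `S`, with intersection `D` and quotients `B`
and `K`. -/
abbrev Span (S : C) : Type v :=
  {t : ((N ⟶ S) × (Y ⟶ S)) × ((S ⟶ B) × (S ⟶ K)) × (D ⟶ S) //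
    SES t.1.1 t.2.1.1 ∧ SES t.1.2 t.2.1.2 ∧ SES t.2.2 (biprod.lift t.2.1.1 t.2.1.2)}

/-- A span of subobjects amounts to a pushout square. -/
noncomputable def spanEquiv (S : C) : Span N Y B K D S ≃
    Σ p : P N K D × P Y B D, {t : (N ⟶ S) × (Y ⟶ S) // IsPushout p.1.1.1 p.2.1.1 t.1 t.2} where
  toFun t :=
    have w : t.1.2.2 ≫ t.1.2.1.1 = 0 := by simpa using t.2.2.2.w =≫ biprod.fst
    have w' : t.1.2.2 ≫ t.1.2.1.2 = 0 := by simpa using t.2.2.2.w =≫ biprod.snd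
    have e₁ := (t.2.1.exists_lift _ w).choose_spec
    have e₂ := (t.2.2.1.exists_lift _ w').choose_spec
    ⟨(⟨(_, t.1.1.1 ≫ t.1.2.1.2), t.2.1.lift_diagonal t.2.2.2 e₁⟩,
      ⟨(_, t.1.1.2 ≫ t.1.2.1.1), t.2.2.1.lift_diagonal t.2.2.2.swap_biprod e₂⟩),
      t.1.1, t.2.1.isPushout_diagonal t.2.2.1 t.2.2.2 e₁ e₂⟩
  invFun t :=
    have w : t.1.1.1.1 ≫ 0 = t.1.2.1.1 ≫ t.1.2.1.2 := by rw [t.1.2.2.w, comp_zero]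
    have w' : t.1.1.1.1 ≫ t.1.1.1.2 = t.1.2.1.1 ≫ 0 := by rw [t.1.1.2.w, comp_zero]
    ⟨(t.2.1, (t.2.2.desc 0 t.1.2.1.2 w, t.2.2.desc t.1.1.1.2 0 w'), t.1.1.1.1 ≫ t.2.1.1),
      t.1.2.2.pushout_right t.2.2 (t.2.2.inl_desc _ _ _) (t.2.2.inr_desc _ _ _),
      t.1.1.2.pushout_right t.2.2.flip (t.2.2.inr_desc _ _ _) (t.2.2.inl_desc _ _ _),
      SES.pushout_diagonal t.1.1.2 t.1.2.2 t.2.2 (t.2.2.inl_desc _ _ _) (t.2.2.inr_desc _ _ _)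
        (t.2.2.inl_desc _ _ _) (t.2.2.inr_desc _ _ _)⟩
  left_inv t := by
    have w : t.1.2.2 ≫ t.1.2.1.1 = 0 := by simpa using t.2.2.2.w =≫ biprod.fst
    have w' : t.1.2.2 ≫ t.1.2.1.2 = 0 := by simpa using t.2.2.2.w =≫ biprod.snd
    have e₁ := (t.2.1.exists_lift _ w).choose_spec
    have e₂ := (t.2.2.1.exists_lift _ w').choose_spec
    have hp := t.2.1.isPushout_diagonal t.2.2.1 t.2.2.2 e₁ e₂
    refine Subtype.ext (Prod.ext rfl (Prod.ext (Prod.ext (hp.hom_ext ?_ ?_) (hp.hom_ext ?_ ?_)) e₁))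
    · exact (hp.inl_desc _ _ _).trans t.2.1.w.symm
    · exact hp.inr_desc _ _ _
    · exact hp.inl_desc _ _ _
    · exact (hp.inr_desc _ _ _).trans t.2.2.1.w.symm
  right_inv t := by
    obtain ⟨⟨⟨⟨d₁, c₁⟩, h₁⟩, ⟨⟨d₂, c₂⟩, h₂⟩⟩, ⟨⟨n, y⟩, hp⟩⟩ := t
    have := h₁.mono
    have := h₂.mono
    have : Mono n := Abelian.mono_inl_of_isColimit _ _ hp.isColimit
    have : Mono y := Abelian.mono_inr_of_isColimit _ _ hp.isColimit
    have k₁ : ∀ x : D ⟶ N, x ≫ n = d₁ ≫ n → x = d₁ := fun x hx => (cancel_mono n).1 hx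
    have k₂ : ∀ x : D ⟶ Y, x ≫ y = d₁ ≫ n → x = d₂ := fun x hx =>
      (cancel_mono y).1 (hx.trans hp.w)
    have key : ∀ (x₁ : D ⟶ N) (x₂ : D ⟶ Y) (z₁ : N ⟶ K) (z₂ : Y ⟶ B) (i₁ : SES x₁ z₁)
        (i₂ : SES x₂ z₂) (i : IsPushout x₁ x₂ n y), x₁ = d₁ → x₂ = d₂ → z₁ = c₁ → z₂ = c₂ →
        (⟨(⟨(x₁, z₁), i₁⟩, ⟨(x₂, z₂), i₂⟩), ⟨(n, y), i⟩⟩ : Σ p : P N K D × P Y B D,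
          {t : (N ⟶ S) × (Y ⟶ S) // IsPushout p.1.1.1 p.2.1.1 t.1 t.2}) =
          ⟨(⟨(d₁, c₁), h₁⟩, ⟨(d₂, c₂), h₂⟩), ⟨(n, y), hp⟩⟩ := by
      rintro _ _ _ _ _ _ _ rfl rfl rfl rfl
      rfl
    refine key _ _ _ _ _ _ _ (k₁ _ ?_) (k₂ _ ?_) (hp.inl_desc _ _ _) (hp.inr_desc _ _ _)
    · exact Exists.choose_spec (p := fun t : D ⟶ N => t ≫ n = d₁ ≫ n) _
    · exact Exists.choose_spec (p := fun t : D ⟶ Y => t ≫ y = d₁ ≫ n) _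

lemma tsum_wt_mul_cnt_span [∀ X Y : C, Finite (X ⟶ Y)] (N Y B K D : C) :
    ∑' S : IsoCls C, wt S * cnt (Span N Y B K D S.out) = cnt (P N K D) * cnt (P Y B D) := by
  have h (S : IsoCls C) : wt S * cnt (Span N Y B K D S.out) =
      ∑' p : P N K D × P Y B D, wt S * cnt (pushout p.1.1.1 p.2.1.1 ≅ S.out) := by
    rw [cnt_congr (spanEquiv S.out), cnt_sigma, ENNReal.tsum_mul_left]
    exact congrArg _ (tsum_congr fun p => cnt_congr (pushoutEquiv _ _ _))
  rw [tsum_congr h, ENNReal.tsum_comm, tsum_congr fun p => tsum_wt_mul_cnt _, ← cnt_prod]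
  rfl

end Pushout

end

section

open scoped ENNReal

/-- Factorizations of `biprod.desc a a'` as an epimorphism to `S` followed by a monomorphism. -/
abbrev Factorization {N Y E : C} (a : N ⟶ E) (a' : Y ⟶ E) (S : C) : Type v :=
  {z : ((N ⟶ S) × (Y ⟶ S)) × (S ⟶ E) //
    Epi (biprod.desc z.1.1 z.1.2) ∧ Mono z.2 ∧ z.1.1 ≫ z.2 = a ∧ z.1.2 ≫ z.2 = a'}

/-- The epi-mono factorizations of a morphism are parametrized by isomorphisms. -/
noncomputable def factorizationEquiv {N Y E : C} (a : N ⟶ E) (a' : Y ⟶ E) (S : C) :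
    Factorization a a' S ≃ (image (biprod.desc a a') ≅ S) :=
  Equiv.symm <| Equiv.ofBijective
    (fun e => ⟨((biprod.inl ≫ factorThruImage (biprod.desc a a') ≫ e.hom,
      biprod.inr ≫ factorThruImage (biprod.desc a a') ≫ e.hom),
      e.inv ≫ image.ι (biprod.desc a a')), by
        have : biprod.desc (biprod.inl ≫ factorThruImage (biprod.desc a a') ≫ e.hom)
            (biprod.inr ≫ factorThruImage (biprod.desc a a') ≫ e.hom) =
              factorThruImage (biprod.desc a a') ≫ e.hom := by ext <;> simp
        rw [this]
        exact epi_comp _ _, mono_comp _ _, by simp, by simp⟩) (by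
    constructor
    · intro e e' h
      have : e.inv ≫ image.ι (biprod.desc a a') = e'.inv ≫ image.ι (biprod.desc a a') :=
        congrArg (fun z => z.1.2) h
      exact Iso.ext_inv ((cancel_mono _).1 this)
    · rintro ⟨⟨⟨n, y⟩, s⟩, hn, hs, h₁, h₂⟩
      dsimp only at hn hs h₁ h₂
      have := strongEpi_of_epi (biprod.desc n y)
      have w : biprod.desc n y ≫ s = biprod.desc a a' := by ext <;> simp [h₁, h₂]
      let i := image.isoStrongEpiMono (biprod.desc n y) s w
      have k₁ : i.hom ≫ image.ι (biprod.desc a a') = s :=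
        image.isoStrongEpiMono_hom_comp_ι _ _ _
      have k₂ : factorThruImage (biprod.desc a a') ≫ i.inv = biprod.desc n y := by
        rw [← cancel_mono s, w, ← k₁, Category.assoc, i.inv_hom_id_assoc, image.fac]
      refine ⟨i.symm, Subtype.ext (Prod.ext (Prod.ext ?_ ?_) k₁)⟩
      · exact (biprod.inl ≫= k₂).trans (biprod.inl_desc _ _)
      · exact (biprod.inr ≫= k₂).trans (biprod.inr_desc _ _))

/-- Pairs of morphisms to `S` which are jointly epimorphic. -/
abbrev EpiPair (N Y S : C) : Type v := {t : (N ⟶ S) × (Y ⟶ S) // Epi (biprod.desc t.1 t.2)}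

section

variable [∀ X Y : C, Finite (X ⟶ Y)]

lemma tsum_wt_mul_tsum_wt_mul_cnt_eq_one {N Y E : C} (a : N ⟶ E) (a' : Y ⟶ E) :
    ∑' S : IsoCls C, wt S * ∑' A : IsoCls C, wt A *
      cnt {z : EpiPair N Y S.out × P E A.out S.out //
        (z.1.1.1 ≫ z.2.1.1, z.1.1.2 ≫ z.2.1.1) = (a, a')} = 1 := by
  rw [← tsum_wt_mul_cnt_of_equiv _ fun S => factorizationEquiv a a' S.out]
  refine tsum_congr fun S => congrArg _ ?_
  have h (A : IsoCls C) : wt A * cnt {z : EpiPair N Y S.out × P E A.out S.out //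
      (z.1.1.1 ≫ z.2.1.1, z.1.1.2 ≫ z.2.1.1) = (a, a')} =
        ∑' z : Factorization a a' S.out, wt A * cnt {p : E ⟶ A.out // SES z.1.2 p} := by
    rw [ENNReal.tsum_mul_left, ← cnt_sigma]
    exact congrArg _ (cnt_congr
      { toFun z := ⟨⟨(z.1.1.1, z.1.2.1.1), z.1.1.2, z.1.2.2.mono, congrArg Prod.fst z.2,
          congrArg Prod.snd z.2⟩, z.1.2.1.2, z.1.2.2⟩
        invFun z := ⟨(⟨z.1.1.1, z.1.2.1⟩, ⟨(z.1.1.2, z.2.1), z.2.2⟩),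
          Prod.ext z.1.2.2.2.1 z.1.2.2.2.2⟩
        left_inv _ := rfl
        right_inv _ := rfl })
  rw [tsum_congr h, ENNReal.tsum_comm, cnt]
  refine tsum_congr fun z => ?_
  have := z.2.2.1
  exact tsum_wt_mul_cnt_of_equiv _ fun A => (SES.of_mono z.1.2).cokernelEquiv A.out

lemma cnt_P (L M N : C) : cnt (P L M N) = ∑' a : N ⟶ L, cnt {b : L ⟶ M // SES a b} := by
  rw [← cnt_sigma]
  exact cnt_congr
    { toFun p := ⟨p.1.1, p.1.2, p.2⟩
      invFun p := ⟨(p.1, p.2.1), p.2.2⟩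
      left_inv _ := rfl
      right_inv _ := rfl }

/-- A pair of subobjects `N` and `Y` of `E` amounts to a subobject `S` of `E` and a pair of
subobjects of `S` spanning it. -/
lemma cnt_P_mul_cnt_P (E M N X Y : C) : cnt (P E M N) * cnt (P E X Y) =
    ∑' S : IsoCls C, wt S * ∑' A : IsoCls C, wt A * ∑' t : EpiPair N Y S.out,
      ∑' p : P E A.out S.out, cnt {b : E ⟶ M // SES (t.1.1 ≫ p.1.1) b} *
        cnt {b : E ⟶ X // SES (t.1.2 ≫ p.1.1) b} := by
  let G (z : (N ⟶ E) × (Y ⟶ E)) : ℝ≥0∞ :=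
    cnt {b : E ⟶ M // SES z.1 b} * cnt {b : E ⟶ X // SES z.2 b}
  have h₁ : cnt (P E M N) * cnt (P E X Y) = ∑' z, G z := by
    rw [ENNReal.tsum_prod', cnt_P, cnt_P, ← ENNReal.tsum_mul_right]
    exact tsum_congr fun a => ENNReal.tsum_mul_left.symm
  have h₂ (S A : IsoCls C) : wt A * ∑' t : EpiPair N Y S.out,
      ∑' p : P E A.out S.out, cnt {b : E ⟶ M // SES (t.1.1 ≫ p.1.1) b} *
        cnt {b : E ⟶ X // SES (t.1.2 ≫ p.1.1) b} =
      ∑' z, G z * (wt A * cnt {t : EpiPair N Y S.out × P E A.out S.out //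
        (t.1.1.1 ≫ t.2.1.1, t.1.1.2 ≫ t.2.1.1) = z}) := by
    rw [← ENNReal.tsum_prod' (f := fun t : EpiPair N Y S.out × P E A.out S.out =>
      G (t.1.1.1 ≫ t.2.1.1, t.1.1.2 ≫ t.2.1.1)),
      tsum_fiber (fun t : EpiPair N Y S.out × P E A.out S.out =>
        (t.1.1.1 ≫ t.2.1.1, t.1.1.2 ≫ t.2.1.1)) G, ← ENNReal.tsum_mul_left]
    exact tsum_congr fun z => mul_left_comm _ _ _
  have h₃ (S : IsoCls C) : wt S * ∑' A : IsoCls C, wt A * ∑' t : EpiPair N Y S.out,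
      ∑' p : P E A.out S.out, cnt {b : E ⟶ M // SES (t.1.1 ≫ p.1.1) b} *
        cnt {b : E ⟶ X // SES (t.1.2 ≫ p.1.1) b} =
      ∑' z, G z * (wt S * ∑' A : IsoCls C, wt A * cnt {t : EpiPair N Y S.out × P E A.out S.out //
        (t.1.1.1 ≫ t.2.1.1, t.1.1.2 ≫ t.2.1.1) = z}) := by
    rw [tsum_congr (h₂ S), ENNReal.tsum_comm, ← ENNReal.tsum_mul_left]
    refine tsum_congr fun z => ?_
    rw [ENNReal.tsum_mul_left, mul_left_comm]
  rw [tsum_congr h₃, ENNReal.tsum_comm, h₁]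
  refine tsum_congr fun z => ?_
  rw [ENNReal.tsum_mul_left, tsum_wt_mul_tsum_wt_mul_cnt_eq_one z.1 z.2, mul_one]

end

lemma SES.epi_biprod_lift {N Y S B K : C} {n : N ⟶ S} {y : Y ⟶ S} [Epi (biprod.desc n y)]
    {π : S ⟶ B} {π' : S ⟶ K} (hn : SES n π) (hy : SES y π') : Epi (biprod.lift π π') := by
  have := hn.epi
  have := hy.epi
  have hny (T : C) (x : S ⟶ T) (h₁ : n ≫ x = 0) (h₂ : y ≫ x = 0) : x = 0 := by
    rw [← cancel_epi (biprod.desc n y)]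
    ext <;> simp [h₁, h₂]
  rw [Preadditive.epi_iff_cancel_zero]
  intro T x hx
  have hx' : π ≫ biprod.inl ≫ x + π' ≫ biprod.inr ≫ x = 0 := by
    rw [← hx, biprod.lift_eq]; simp
  have h₁ : n ≫ π' ≫ biprod.inr ≫ x = 0 := by
    simpa [reassoc_of% hn.w] using n ≫= hx'
  have h₂ : y ≫ π ≫ biprod.inl ≫ x = 0 := by
    simpa [reassoc_of% hy.w] using y ≫= hx'
  ext
  · rw [← cancel_epi π, comp_zero, comp_zero]
    exact hny _ _ (by rw [reassoc_of% hn.w, zero_comp]) h₂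
  · rw [← cancel_epi π', comp_zero, comp_zero]
    exact hny _ _ h₁ (by rw [reassoc_of% hy.w, zero_comp])

/-- In a span, the two subobjects are jointly epimorphic. -/
lemma epi_biprod_desc_of_SES {N Y S B K D : C} {n : N ⟶ S} {y : Y ⟶ S} {π : S ⟶ B}
    {π' : S ⟶ K} {d : D ⟶ S} (hn : SES n π) (hy : SES y π') (hd : SES d (biprod.lift π π')) :
    Epi (biprod.desc n y) := by
  obtain ⟨d₁, e₁⟩ := hn.exists_lift d (by simpa using hd.w =≫ biprod.fst)
  obtain ⟨d₂, e₂⟩ := hy.exists_lift d (by simpa using hd.w =≫ biprod.snd)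
  have hp := hn.isPushout_diagonal hy hd e₁ e₂
  rw [Preadditive.epi_iff_cancel_zero]
  intro T x hx
  refine hp.hom_ext ?_ ?_
  · simpa using biprod.inl ≫= hx
  · simpa using biprod.inr ≫= hx

section

variable [∀ X Y : C, Finite (X ⟶ Y)]

lemma tsum_wt_mul_cnt_diagonal {N Y S : C} (n : N ⟶ S) (y : Y ⟶ S) [Mono n] [Mono y]
    [Epi (biprod.desc n y)] :
    ∑' B : IsoCls C, wt B * ∑' K : IsoCls C, wt K * ∑' D : IsoCls C, wt D *
      cnt {t : ((S ⟶ B.out) × (S ⟶ K.out)) × (D.out ⟶ S) //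
        SES n t.1.1 ∧ SES y t.1.2 ∧ SES t.2 (biprod.lift t.1.1 t.1.2)} = 1 := by
  rw [← tsum_wt_mul_cnt_of_equiv _ fun B => (SES.of_mono n).cokernelEquiv B.out]
  refine tsum_congr fun B => congrArg _ ?_
  have h (K : IsoCls C) : wt K * ∑' D : IsoCls C, wt D *
      cnt {t : ((S ⟶ B.out) × (S ⟶ K.out)) × (D.out ⟶ S) //
        SES n t.1.1 ∧ SES y t.1.2 ∧ SES t.2 (biprod.lift t.1.1 t.1.2)} =
      cnt {π : S ⟶ B.out // SES n π} * (wt K * cnt {π : S ⟶ K.out // SES y π}) := by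
    rw [mul_left_comm, ← cnt_prod]
    refine congrArg _ ?_
    have h' (D : IsoCls C) : wt D * cnt {t : ((S ⟶ B.out) × (S ⟶ K.out)) × (D.out ⟶ S) //
        SES n t.1.1 ∧ SES y t.1.2 ∧ SES t.2 (biprod.lift t.1.1 t.1.2)} =
        ∑' z : {π : S ⟶ B.out // SES n π} × {π : S ⟶ K.out // SES y π},
          wt D * cnt {d : D.out ⟶ S // SES d (biprod.lift z.1.1 z.2.1)} := by
      rw [ENNReal.tsum_mul_left, ← cnt_sigma]
      exact congrArg _ (cnt_congr
        { toFun t := ⟨(⟨t.1.1.1, t.2.1⟩, ⟨t.1.1.2, t.2.2.1⟩), t.1.2, t.2.2.2⟩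
          invFun t := ⟨((t.1.1.1, t.1.2.1), t.2.1), t.1.1.2, t.1.2.2, t.2.2⟩
          left_inv _ := rfl
          right_inv _ := rfl })
    rw [tsum_congr h', ENNReal.tsum_comm, cnt]
    refine tsum_congr fun z => ?_
    have := z.1.2.epi_biprod_lift z.2.2
    exact tsum_wt_mul_cnt_of_equiv _ fun D =>
      (SES.of_epi (biprod.lift z.1.1 z.2.1)).kernelEquiv D.out
  rw [tsum_congr h, ENNReal.tsum_mul_left,
    tsum_wt_mul_cnt_of_equiv _ fun K => (SES.of_mono y).cokernelEquiv K.out, mul_one]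

/-- Summation over all spans of subobjects. -/
lemma tsum_wt_mul_tsum_span {N Y S : C} (G : (N ⟶ S) × (Y ⟶ S) → ℝ≥0∞)
    (hG : ∀ t, G t ≠ 0 → Mono t.1 ∧ Mono t.2) :
    ∑' t : EpiPair N Y S, G t.1 = ∑' B : IsoCls C, wt B * ∑' K : IsoCls C, wt K *
      ∑' D : IsoCls C, wt D * ∑' t : Span N Y B.out K.out D.out S, G t.1.1 := by
  have h₁ (B K D : IsoCls C) : wt D * ∑' t : Span N Y B.out K.out D.out S, G t.1.1 =
      ∑' z, G z * (wt D * cnt {t : ((S ⟶ B.out) × (S ⟶ K.out)) × (D.out ⟶ S) //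
        SES z.1 t.1.1 ∧ SES z.2 t.1.2 ∧ SES t.2 (biprod.lift t.1.1 t.1.2)}) := by
    rw [tsum_fiber (fun t : Span N Y B.out K.out D.out S => t.1.1) G, ← ENNReal.tsum_mul_left]
    refine tsum_congr fun z => ?_
    rw [mul_left_comm]
    refine congrArg _ (congrArg _ (cnt_congr
      { toFun t := ⟨t.1.1.2, by
          obtain ⟨⟨⟨z, t⟩, ht⟩, rfl⟩ := t
          exact ht⟩
        invFun t := ⟨⟨(z, t.1), t.2⟩, rfl⟩
        left_inv := by
          rintro ⟨⟨⟨z, t⟩, ht⟩, rfl⟩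
          rfl
        right_inv _ := rfl }))
  have h₂ (B K : IsoCls C) : wt K * ∑' D : IsoCls C, wt D *
      ∑' t : Span N Y B.out K.out D.out S, G t.1.1 =
      ∑' z, G z * (wt K * ∑' D : IsoCls C, wt D * cnt {t : ((S ⟶ B.out) × (S ⟶ K.out)) ×
        (D.out ⟶ S) //
          SES z.1 t.1.1 ∧ SES z.2 t.1.2 ∧ SES t.2 (biprod.lift t.1.1 t.1.2)}) := by
    rw [tsum_congr (h₁ B K), ENNReal.tsum_comm, ← ENNReal.tsum_mul_left]
    refine tsum_congr fun z => ?_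
    rw [ENNReal.tsum_mul_left, mul_left_comm]
  have h₃ (B : IsoCls C) : wt B * ∑' K : IsoCls C, wt K * ∑' D : IsoCls C, wt D *
      ∑' t : Span N Y B.out K.out D.out S, G t.1.1 =
      ∑' z, G z * (wt B * ∑' K : IsoCls C, wt K * ∑' D : IsoCls C, wt D *
        cnt {t : ((S ⟶ B.out) × (S ⟶ K.out)) × (D.out ⟶ S) //
          SES z.1 t.1.1 ∧ SES z.2 t.1.2 ∧ SES t.2 (biprod.lift t.1.1 t.1.2)}) := by
    rw [tsum_congr (h₂ B), ENNReal.tsum_comm, ← ENNReal.tsum_mul_left]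
    refine tsum_congr fun z => ?_
    rw [ENNReal.tsum_mul_left, mul_left_comm]
  rw [tsum_congr h₃, ENNReal.tsum_comm]
  refine (tsum_subtype {t : (N ⟶ S) × (Y ⟶ S) | Epi (biprod.desc t.1 t.2)} G).trans
    (tsum_congr fun z => ?_)
  rw [ENNReal.tsum_mul_left]
  by_cases hz : Epi (biprod.desc z.1 z.2)
  · refine (Set.indicator_of_mem (s := {t : (N ⟶ S) × (Y ⟶ S) | Epi (biprod.desc t.1 t.2)})
      hz G).trans ?_
    by_cases h0 : G z = 0
    · rw [h0, zero_mul]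
    · obtain ⟨_, _⟩ := hG z h0
      rw [tsum_wt_mul_cnt_diagonal z.1 z.2, mul_one]
  · refine (Set.indicator_of_notMem (s := {t : (N ⟶ S) × (Y ⟶ S) | Epi (biprod.desc t.1 t.2)})
      hz G).trans ?_
    have (B K D : IsoCls C) : IsEmpty {t : ((S ⟶ B.out) × (S ⟶ K.out)) × (D.out ⟶ S) //
        SES z.1 t.1.1 ∧ SES z.2 t.1.2 ∧ SES t.2 (biprod.lift t.1.1 t.1.2)} :=
      ⟨fun t => hz (epi_biprod_desc_of_SES t.2.1 t.2.2.1 t.2.2.2)⟩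
    simp [cnt_of_isEmpty]

end

end

section

open scoped ENNReal
open Abelian

lemma tsum_mul_tsum_comm {α β : Type*} (f : α → ℝ≥0∞) (g : β → ℝ≥0∞) (h : α → β → ℝ≥0∞) :
    ∑' a, f a * ∑' b, g b * h a b = ∑' b, g b * ∑' a, f a * h a b := by
  simp_rw [← ENNReal.tsum_mul_left]
  rw [ENNReal.tsum_comm]
  exact tsum_congr fun b => tsum_congr fun a => mul_left_comm _ _ _

section

variable [∀ X Y : C, Finite (X ⟶ Y)] [∀ X Y : C, Finite (Ext.{max u v} X Y 1)]

lemma tsum_wt_mul_tsum_epiPair (hhered : ∀ X Y : C, Subsingleton (Ext.{max u v} X Y 2))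
    (S A M N X Y : C) :
    ∑' E : IsoCls C, wt E * ∑' t : EpiPair N Y S, ∑' p : P E.out A S,
        cnt {b : E.out ⟶ M // SES (t.1.1 ≫ p.1.1) b} *
          cnt {b : E.out ⟶ X // SES (t.1.2 ≫ p.1.1) b} =
      ∑' B : IsoCls C, wt B * ∑' K : IsoCls C, wt K * ∑' D : IsoCls C, wt D *
        (cnt (Span N Y B.out K.out D.out S) *
          (cnt (Ext.{max u v} A D.out 1) * (cnt (A ⟶ D.out))⁻¹ *
            (cnt (P M A B.out) * cnt (P X A K.out)))) := by
  let G (z : (N ⟶ S) × (Y ⟶ S)) : ℝ≥0∞ := ∑' E : IsoCls C, wt E * ∑' p : P E.out A S,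
    cnt {b : E.out ⟶ M // SES (z.1 ≫ p.1.1) b} * cnt {b : E.out ⟶ X // SES (z.2 ≫ p.1.1) b}
  have h₁ : ∑' E : IsoCls C, wt E * ∑' t : EpiPair N Y S, ∑' p : P E.out A S,
        cnt {b : E.out ⟶ M // SES (t.1.1 ≫ p.1.1) b} *
          cnt {b : E.out ⟶ X // SES (t.1.2 ≫ p.1.1) b} = ∑' t : EpiPair N Y S, G t.1 := by
    rw [ENNReal.tsum_comm]
    exact tsum_congr fun E => ENNReal.tsum_mul_left.symm
  have hG (z : (N ⟶ S) × (Y ⟶ S)) (hz : G z ≠ 0) : Mono z.1 ∧ Mono z.2 := by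
    obtain ⟨E, hE⟩ := not_forall.1 (mt ENNReal.tsum_eq_zero.2 hz)
    obtain ⟨p, hp⟩ := not_forall.1 (mt ENNReal.tsum_eq_zero.2 (right_ne_zero_of_mul hE))
    have aux {T Z : C} (f : T ⟶ E.out) (h : cnt {b : E.out ⟶ Z // SES f b} ≠ 0) : Mono f := by
      by_contra hf
      have : IsEmpty {b : E.out ⟶ Z // SES f b} := ⟨fun b => hf b.2.mono⟩
      exact h cnt_of_isEmpty
    have := aux _ (left_ne_zero_of_mul hp)
    have := aux _ (right_ne_zero_of_mul hp)
    exact ⟨mono_of_mono z.1 p.1.1, mono_of_mono z.2 p.1.1⟩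
  rw [h₁, tsum_wt_mul_tsum_span G hG]
  refine tsum_congr fun B => congrArg _ (tsum_congr fun K => congrArg _
    (tsum_congr fun D => congrArg _ ?_))
  rw [← tsum_const_eq_cnt_mul]
  exact tsum_congr fun t => tsum_wt_mul_tsum_cokernels hhered t.2.1 t.2.2.1 t.2.2.2 A M X

/-- **Green's formula**, in terms of the numbers of short exact sequences. -/
theorem green (hhered : ∀ X Y : C, Subsingleton (Ext.{max u v} X Y 2)) (M N X Y : C) :
    ∑' E : IsoCls C, wt E * (cnt (P E.out M N) * cnt (P E.out X Y)) =
      ∑' A : IsoCls C, wt A * ∑' B : IsoCls C, wt B * ∑' K : IsoCls C, wt K *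
        ∑' D : IsoCls C, wt D * (cnt (Ext.{max u v} A.out D.out 1) *
          (cnt (A.out ⟶ D.out))⁻¹ * (cnt (P M A.out B.out) * cnt (P X A.out K.out)) *
            (cnt (P N K.out D.out) * cnt (P Y B.out D.out))) := by
  let c (A B K D : IsoCls C) : ℝ≥0∞ := cnt (Ext.{max u v} A.out D.out 1) *
    (cnt (A.out ⟶ D.out))⁻¹ * (cnt (P M A.out B.out) * cnt (P X A.out K.out))
  calc
    _ = ∑' E : IsoCls C, wt E * ∑' S : IsoCls C, wt S * ∑' A : IsoCls C, wt A *
          ∑' t : EpiPair N Y S.out, ∑' p : P E.out A.out S.out,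
            cnt {b : E.out ⟶ M // SES (t.1.1 ≫ p.1.1) b} *
              cnt {b : E.out ⟶ X // SES (t.1.2 ≫ p.1.1) b} :=
      tsum_congr fun E => congrArg _ (cnt_P_mul_cnt_P _ _ _ _ _)
    _ = ∑' S : IsoCls C, wt S * ∑' A : IsoCls C, wt A * ∑' B : IsoCls C, wt B *
          ∑' K : IsoCls C, wt K * ∑' D : IsoCls C, wt D *
            (cnt (Span N Y B.out K.out D.out S.out) * c A B K D) := by
      rw [tsum_mul_tsum_comm]
      refine tsum_congr fun S => congrArg _ ?_
      rw [tsum_mul_tsum_comm]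
      exact tsum_congr fun A => congrArg _ (tsum_wt_mul_tsum_epiPair hhered _ _ _ _ _ _)
    _ = _ := by
      rw [tsum_mul_tsum_comm]
      refine tsum_congr fun A => congrArg _ ?_
      rw [tsum_mul_tsum_comm]
      refine tsum_congr fun B => congrArg _ ?_
      rw [tsum_mul_tsum_comm]
      refine tsum_congr fun K => congrArg _ ?_
      rw [tsum_mul_tsum_comm]
      refine tsum_congr fun D => congrArg _ ?_
      rw [← tsum_wt_mul_cnt_span, mul_comm, ← ENNReal.tsum_mul_right]
      exact tsum_congr fun S => (mul_assoc _ _ _).symm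

end

end

section

open scoped ENNReal
open Abelian

/-- The short exact sequences with a given subobject. -/
noncomputable def subobjectFiberEquiv {L : C} (M N : C) (L' : Subobject L) :
    {p : P L M N // ∃ _ : Mono p.1.1, Subobject.mk p.1.1 = L'} ≃
      (N ≅ (L' : C)) × (cokernel L'.arrow ≅ M) :=
  Equiv.symm <| Equiv.ofBijective
    (fun e => ⟨⟨(e.1.hom ≫ L'.arrow, cokernel.π L'.arrow ≫ e.2.hom),
        ((SES.of_mono L'.arrow).iso_comp e.1).comp_iso e.2⟩, mono_comp _ _,
      (Subobject.mk_eq_mk_of_comm _ _ e.1 rfl).trans (Subobject.mk_arrow L')⟩) (by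
    constructor
    · rintro ⟨e, f⟩ ⟨e', f'⟩ h
      have h₁ : e.hom ≫ L'.arrow = e'.hom ≫ L'.arrow := congrArg (fun p => p.1.1.1) h
      have h₂ : cokernel.π L'.arrow ≫ f.hom = cokernel.π L'.arrow ≫ f'.hom :=
        congrArg (fun p => p.1.1.2) h
      exact Prod.ext (Iso.ext ((cancel_mono _).1 h₁)) (Iso.ext ((cancel_epi _).1 h₂))
    · rintro ⟨⟨⟨a, b⟩, h⟩, hm, rfl⟩
      dsimp only at h hm ⊢
      let e := (Subobject.underlyingIso a).symm
      have he : e.hom ≫ (Subobject.mk a).arrow = a := Subobject.underlyingIso_arrow a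
      have h' : SES (Subobject.mk a).arrow b := by
        have k : e.symm.hom ≫ a = (Subobject.mk a).arrow :=
          Subobject.underlyingIso_hom_comp_eq_mk a
        rw [← k]
        exact h.iso_comp e.symm
      obtain ⟨f, hf⟩ := ((SES.of_mono (Subobject.mk a).arrow).cokernelEquiv M).symm.surjective
        ⟨b, h'⟩
      refine ⟨(e, f), Subtype.ext (Subtype.ext (Prod.ext he ?_))⟩
      exact congrArg Subtype.val hf)

lemma cnt_iso_eq_aut {X Y : C} (e : X ≅ Y) : cnt (X ≅ Y) = cnt (Y ≅ Y) :=
  cnt_congr (isoCompEquiv e Y)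

variable [∀ X Y : C, Finite (X ⟶ Y)]

lemma aut_ne_zero (X : C) : aut X ≠ 0 :=
  have : Nonempty (Aut X) := ⟨Iso.refl X⟩
  have : Finite (Aut X) := inferInstanceAs (Finite (X ≅ X))
  Nat.card_pos.ne'

section Euler

variable {F : Type} [Field F] [Fintype F] [CategoryTheory.Linear F C]
  [∀ X Y : C, Finite (Ext.{max u v} X Y 1)]

lemma pow_log_card (W : Type*) [AddCommGroup W] [Module F W] [Finite W] :
    Fintype.card F ^ Nat.log (Fintype.card F) (Nat.card W) = Nat.card W := by
  rw [← Nat.card_eq_fintype_card, Module.natCard_eq_pow_finrank (K := F) (V := W), Nat.log_pow]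
  rw [Nat.card_eq_fintype_card]
  exact Fintype.one_lt_card

variable (F) in
lemma zpow_euler (X Y : C) : (Fintype.card F : ℂ) ^ euler (Fintype.card F) X Y =
    Nat.card (X ⟶ Y) * (Nat.card (Ext.{max u v} X Y 1) : ℂ)⁻¹ := by
  rw [euler, zpow_sub₀ (Nat.cast_ne_zero.2 Fintype.card_ne_zero), zpow_natCast, zpow_natCast,
    ← Nat.cast_pow, ← Nat.cast_pow, pow_log_card, pow_log_card, div_eq_mul_inv]

variable (F) in
lemma zpow_card_injective : Function.Injective fun n : ℤ => (Fintype.card F : ℂ) ^ n := by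
  intro m n h
  have h' : (Fintype.card F : ℝ) ^ m = (Fintype.card F : ℝ) ^ n := by
    refine Complex.ofReal_injective ?_
    push_cast
    exact h
  have : (1 : ℝ) < Fintype.card F := by exact_mod_cast Fintype.one_lt_card
  exact zpow_right_injective₀ (by positivity) this.ne' h'

lemma SES.euler_left (hhered : ∀ X Y : C, Subsingleton (Ext.{max u v} X Y 2)) {L M N : C}
    {a : N ⟶ L} {b : L ⟶ M} (h : SES a b) (T : C) :
    euler (Fintype.card F) L T =
      euler (Fintype.card F) M T + euler (Fintype.card F) N T := by
  refine zpow_card_injective F ?_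
  have hc := h.card_contravariant hhered T
  have hc' : (Nat.card (M ⟶ T) * Nat.card (N ⟶ T) * Nat.card (Ext.{max u v} L T 1) : ℂ) =
      Nat.card (L ⟶ T) * Nat.card (Ext.{max u v} M T 1) * Nat.card (Ext.{max u v} N T 1) := by
    exact_mod_cast hc
  have hne (X : C) : (Nat.card (Ext.{max u v} X T 1) : ℂ) ≠ 0 :=
    Nat.cast_ne_zero.2 Nat.card_pos.ne'
  have := hne L
  have := hne M
  have := hne N
  dsimp only
  rw [zpow_add₀ (Nat.cast_ne_zero.2 Fintype.card_ne_zero), zpow_euler, zpow_euler, zpow_euler]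
  field_simp
  linear_combination -hc'

lemma SES.euler_right (hhered : ∀ X Y : C, Subsingleton (Ext.{max u v} X Y 2)) {L M N : C}
    {a : N ⟶ L} {b : L ⟶ M} (h : SES a b) (T : C) :
    euler (Fintype.card F) T L =
      euler (Fintype.card F) T M + euler (Fintype.card F) T N := by
  refine zpow_card_injective F ?_
  have hc := h.card_covariant hhered T
  have hc' : (Nat.card (T ⟶ N) * Nat.card (T ⟶ M) * Nat.card (Ext.{max u v} T L 1) : ℂ) =
      Nat.card (T ⟶ L) * Nat.card (Ext.{max u v} T N 1) * Nat.card (Ext.{max u v} T M 1) := by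
    exact_mod_cast hc
  have hne (X : C) : (Nat.card (Ext.{max u v} T X 1) : ℂ) ≠ 0 :=
    Nat.cast_ne_zero.2 Nat.card_pos.ne'
  have := hne L
  have := hne M
  have := hne N
  dsimp only
  rw [zpow_add₀ (Nat.cast_ne_zero.2 Fintype.card_ne_zero), zpow_euler, zpow_euler, zpow_euler]
  field_simp
  linear_combination -hc'

end Euler

variable [∀ X : C, Finite (Subobject X)]

lemma cnt_P_eq (L M N : C) :
    cnt (P L M N) = hallNum L M N * (cnt (N ≅ N) * cnt (M ≅ M)) := by
  let f (p : P L M N) : Subobject L := haveI := p.2.mono; Subobject.mk p.1.1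
  have h (L' : Subobject L) : {p // f p = L'} ≃ (N ≅ (L' : C)) × (cokernel L'.arrow ≅ M) :=
    (Equiv.subtypeEquivRight fun p => ⟨fun h => ⟨p.2.mono, h⟩, fun ⟨_, h⟩ => h⟩).trans
      (subobjectFiberEquiv M N L')
  let s : Set (Subobject L) :=
    {L' | Nonempty ((L' : C) ≅ N) ∧ Nonempty (cokernel L'.arrow ≅ M)}
  have hs : (hallNum L M N : ℝ≥0∞) = cnt s := cnt_eq_card.symm
  rw [hs, ← tsum_const_eq_cnt_mul, tsum_subtype s fun _ => cnt (N ≅ N) * cnt (M ≅ M), cnt_fiber f]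
  refine tsum_congr fun L' => ?_
  rw [cnt_congr (h L')]
  by_cases hL : L' ∈ s
  · rw [Set.indicator_of_mem hL]
    obtain ⟨⟨e⟩, ⟨e'⟩⟩ := hL
    have k : cnt (N ≅ (L' : C)) = cnt ((L' : C) ≅ N) :=
      cnt_congr ⟨Iso.symm, Iso.symm, fun _ => rfl, fun _ => rfl⟩
    rw [cnt_prod, cnt_iso_eq_aut e', k, cnt_iso_eq_aut e]
  · rw [Set.indicator_of_notMem hL]
    have : IsEmpty ((N ≅ (L' : C)) × (cokernel L'.arrow ≅ M)) :=
      ⟨fun e => hL ⟨⟨e.1.symm⟩, ⟨e.2⟩⟩⟩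
    exact cnt_of_isEmpty

/-- Riedtmann's count of short exact sequences. -/
lemma card_P (L M N : C) : Nat.card (P L M N) = hallNum L M N * aut M * aut N := by
  have h := cnt_P_eq L M N
  have hM : Nat.card (M ≅ M) = aut M := rfl
  have hN : Nat.card (N ≅ N) = aut N := rfl
  rw [cnt_eq_card, cnt_eq_card, cnt_eq_card, hM, hN] at h
  rw [mul_assoc, mul_comm (aut M)]
  exact_mod_cast h

end

section

open scoped ENNReal NNReal
open Abelian

variable [∀ X Y : C, Finite (X ⟶ Y)]

lemma wt_eq_coe (S : IsoCls C) : wt S = ((aut S.out : ℝ≥0)⁻¹ : ℝ≥0) := by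
  rw [ENNReal.coe_inv (Nat.cast_ne_zero.2 (aut_ne_zero _)), wt, cnt_eq_card]
  rfl

lemma cnt_eq_coe (T : Type*) [Finite T] : cnt T = ((Nat.card T : ℝ≥0) : ℝ≥0∞) := by
  rw [cnt_eq_card, ENNReal.coe_natCast]

/-- There are finitely many isomorphism classes of extensions. -/
lemma finite_setOf_nonempty_P [∀ X Y : C, Finite (Ext.{max u v} X Y 1)] (M N : C) :
    {E : IsoCls C | Nonempty (P E.out M N)}.Finite := by
  refine Finite.of_injective (fun E : {E : IsoCls C | Nonempty (P E.out M N)} =>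
    (Classical.choice E.2).cls) fun E E' h => Subtype.ext ?_
  have θ := (Classical.choice E.2).2.isoEquivHom (Classical.choice E'.2).2 h 0
  exact ((Quotient.out_eq E.1).symm.trans (cls_eq_of_iso θ.1))

lemma eq_of_out_iso {S T : IsoCls C} (e : S.out ≅ T.out) : S = T :=
  (Quotient.out_eq S).symm.trans (cls_eq_of_iso e)

/-- There are finitely many isomorphism classes of subobjects and quotients. -/
lemma finite_setOf_nonempty_P_left [∀ X : C, Finite (Subobject X)] (L : C) :
    {z : IsoCls C × IsoCls C | Nonempty (P L z.1.out z.2.out)}.Finite := by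
  refine Finite.of_injective (fun z : {z : IsoCls C × IsoCls C | Nonempty (P L z.1.out z.2.out)} =>
    haveI := (Classical.choice z.2).2.mono
    Subobject.mk (Classical.choice z.2).1.1) fun z z' h => Subtype.ext ?_
  have h₁ := (Classical.choice z.2).2
  have h₂ := (Classical.choice z'.2).2
  have := h₁.mono
  have := h₂.mono
  let e := Subobject.isoOfMkEqMk _ _ h
  have he : e.hom ≫ (Classical.choice z'.2).1.1 = (Classical.choice z.2).1.1 :=
    Subobject.ofMkLEMk_comp _
  have h₃ : SES (Classical.choice z.2).1.1 (Classical.choice z'.2).1.2 := by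
    rw [← he]
    exact h₂.iso_comp e
  exact Prod.ext (eq_of_out_iso (h₁.cokernelEquiv _ ⟨_, h₃⟩)) (eq_of_out_iso e)

/-- Green's formula as an identity of finite sums of complex numbers. -/
lemma green_sum [∀ X Y : C, Finite (Ext.{max u v} X Y 1)]
    (hhered : ∀ X Y : C, Subsingleton (Ext.{max u v} X Y 2)) (M N X Y : C) (T : Finset (IsoCls C))
    (hT : ∀ E ∉ T, IsEmpty (P E.out M N))
    (hM₁ : ∀ A ∉ T, ∀ B : IsoCls C, IsEmpty (P M A.out B.out))
    (hM₂ : ∀ A, ∀ B ∉ T, IsEmpty (P M (A : IsoCls C).out B.out))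
    (hN₁ : ∀ A ∉ T, ∀ B : IsoCls C, IsEmpty (P N A.out B.out))
    (hN₂ : ∀ A, ∀ B ∉ T, IsEmpty (P N (A : IsoCls C).out B.out)) :
    ∑ E ∈ T, (aut E.out : ℂ)⁻¹ * (Nat.card (P E.out M N) * Nat.card (P E.out X Y)) =
      ∑ A ∈ T, (aut A.out : ℂ)⁻¹ * ∑ B ∈ T, (aut B.out : ℂ)⁻¹ *
        ∑ K ∈ T, (aut K.out : ℂ)⁻¹ * ∑ D ∈ T, (aut D.out : ℂ)⁻¹ *
          (Nat.card (Ext.{max u v} A.out D.out 1) * (Nat.card (A.out ⟶ D.out) : ℂ)⁻¹ *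
            (Nat.card (P M A.out B.out) * Nat.card (P X A.out K.out)) *
              (Nat.card (P N K.out D.out) * Nat.card (P Y B.out D.out))) := by
  have h : ∑ E ∈ T, (aut E.out : ℝ≥0)⁻¹ * (Nat.card (P E.out M N) * Nat.card (P E.out X Y)) =
      ∑ A ∈ T, (aut A.out : ℝ≥0)⁻¹ * ∑ B ∈ T, (aut B.out : ℝ≥0)⁻¹ *
        ∑ K ∈ T, (aut K.out : ℝ≥0)⁻¹ * ∑ D ∈ T, (aut D.out : ℝ≥0)⁻¹ *
          (Nat.card (Ext.{max u v} A.out D.out 1) * (Nat.card (A.out ⟶ D.out) : ℝ≥0)⁻¹ *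
            (Nat.card (P M A.out B.out) * Nat.card (P X A.out K.out)) *
              (Nat.card (P N K.out D.out) * Nat.card (P Y B.out D.out))) := by
    refine ENNReal.coe_injective ?_
    refine Eq.trans ?_ ((green hhered M N X Y).trans ?_)
    · rw [tsum_eq_sum (s := T) fun E hE => ?_, ENNReal.ofNNReal_finsetSum]
      · refine Finset.sum_congr rfl fun E _ => ?_
        rw [ENNReal.coe_mul, ENNReal.coe_mul, wt_eq_coe, cnt_eq_coe, cnt_eq_coe]
      · have := hT E hE
        rw [cnt_of_isEmpty, zero_mul, mul_zero]
    · rw [tsum_eq_sum (s := T) fun A hA => ?_, ENNReal.ofNNReal_finsetSum]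
      · refine Finset.sum_congr rfl fun A _ => ?_
        rw [ENNReal.coe_mul, wt_eq_coe]
        refine congrArg _ ?_
        rw [tsum_eq_sum (s := T) fun B hB => ?_, ENNReal.ofNNReal_finsetSum]
        · refine Finset.sum_congr rfl fun B _ => ?_
          rw [ENNReal.coe_mul, wt_eq_coe]
          refine congrArg _ ?_
          rw [tsum_eq_sum (s := T) fun K hK => ?_, ENNReal.ofNNReal_finsetSum]
          · refine Finset.sum_congr rfl fun K _ => ?_
            rw [ENNReal.coe_mul, wt_eq_coe]
            refine congrArg _ ?_
            rw [tsum_eq_sum (s := T) fun D hD => ?_, ENNReal.ofNNReal_finsetSum]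
            · refine Finset.sum_congr rfl fun D _ => ?_
              have : (Nat.card (A.out ⟶ D.out) : ℝ≥0) ≠ 0 := Nat.cast_ne_zero.2 Nat.card_pos.ne'
              simp only [ENNReal.coe_mul, wt_eq_coe, cnt_eq_coe, ENNReal.coe_inv this]
            · have := hN₂ K D hD
              simp [cnt_of_isEmpty]
          · have := hN₁ K hK
            simp [cnt_of_isEmpty]
        · have := hM₂ A B hB
          simp [cnt_of_isEmpty]
      · have := hM₁ A hA
        simp [cnt_of_isEmpty]
  have h' := congrArg (fun x : ℝ≥0 => ((x : ℝ) : ℂ)) h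
  push_cast at h'
  exact h'

end

section

open Abelian

section Coefficients

/-- The coefficient of `u_[l]`. -/
noncomputable def coeff (l : IsoCls C) : Hall C →ₗ[ℂ] ℂ :=
  (Finsupp.lapply l : (IsoCls C →₀ ℂ) →ₗ[ℂ] ℂ)

/-- The coefficient of `u_[z.1] ⊗ u_[z.2]`. -/
noncomputable def coeff₂ (z : IsoCls C × IsoCls C) : Hall2 C →ₗ[ℂ] ℂ :=
  (Finsupp.lapply z : (IsoCls C × IsoCls C →₀ ℂ) →ₗ[ℂ] ℂ)

lemma hall2_ext {f g : Hall2 C} (h : ∀ z, coeff₂ z f = coeff₂ z g) : f = g :=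
  Finsupp.ext h

lemma finsum_smul_single_apply {α : Type*} (c : α → ℂ) (hc : (Function.support c).Finite) (k : α) :
    (∑ᶠ l, c l • Finsupp.single l (1 : ℂ)) k = c k := by
  rw [finsum_eq_sum_of_support_subset (s := hc.toFinset) _ fun l hl => ?_,
    Finsupp.finsetSum_apply]
  · simp only [Finsupp.smul_apply, Finsupp.single_apply, smul_eq_mul, mul_ite, mul_one, mul_zero,
      Finset.sum_ite_eq', Set.Finite.mem_toFinset, Function.mem_support]
    split_ifs with h
    · rfl
    · exact (not_not.1 h).symm
  · rw [Set.Finite.coe_toFinset]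
    rintro h
    exact hl (by simp [h])

lemma coeff_mulBasis (v : ℂ) (q : ℕ) (a b l : IsoCls C)
    (h : {l : IsoCls C | hallNum l.out a.out b.out ≠ 0}.Finite) :
    coeff l (mulBasis v q a b) = v ^ euler q a.out b.out * hallNum l.out a.out b.out :=
  finsum_smul_single_apply (fun l : IsoCls C => v ^ euler q a.out b.out *
    (hallNum l.out a.out b.out : ℂ)) (h.subset fun l hl hl' => hl (by simp [hl'])) l

lemma coeff₂_deltaBasis (v : ℂ) (q : ℕ) (l : IsoCls C) (z : IsoCls C × IsoCls C)
    (h : {z : IsoCls C × IsoCls C | hallNum l.out z.1.out z.2.out ≠ 0}.Finite) :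
    coeff₂ z (deltaBasis v q l) = v ^ euler q z.1.out z.2.out *
      (hallNum l.out z.1.out z.2.out * aut z.1.out * aut z.2.out : ℂ) / (aut l.out : ℂ) :=
  finsum_smul_single_apply (fun z : IsoCls C × IsoCls C => v ^ euler q z.1.out z.2.out *
    (hallNum l.out z.1.out z.2.out * aut z.1.out * aut z.2.out : ℂ) / (aut l.out : ℂ))
    (h.subset fun l hl hl' => hl (by simp [hl'])) z

lemma hmul_u (v : ℂ) (q : ℕ) (M N : C) : hmul v q (u M) (u N) = mulBasis v q (cls M) (cls N) := by
  unfold hmul u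
  rw [Finsupp.sum_single_index, Finsupp.sum_single_index, one_mul, one_smul]
  · rw [mul_zero, zero_smul]
  · simp [Finsupp.sum]

lemma delta_u (v : ℂ) (q : ℕ) (M : C) : delta v q (u M) = deltaBasis v q (cls M) := by
  unfold delta u
  rw [Finsupp.sum_single_index, one_smul]
  rw [zero_smul]

lemma coeff₂_delta (v : ℂ) (q : ℕ) (f : Hall C) (T : Finset (IsoCls C))
    (hT : ∀ l ∉ T, coeff l f = 0) (z : IsoCls C × IsoCls C) :
    coeff₂ z (delta v q f) = ∑ l ∈ T, coeff l f * coeff₂ z (deltaBasis v q l) := by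
  refine (map_sum (coeff₂ z) _ _).trans ?_
  refine (Finset.sum_congr rfl fun l _ => map_smul (coeff₂ z) _ _).trans ?_
  refine Finset.sum_subset (fun l hl => ?_) fun l _ hl => ?_
  · by_contra h
    exact Finsupp.mem_support_iff.1 hl (hT l h)
  · exact mul_eq_zero_of_left (Finsupp.notMem_support_iff.1 hl) _

lemma coeff₂_combine (f g : Hall C) (z : IsoCls C × IsoCls C) :
    coeff₂ z (combine f g) = coeff z.1 f * coeff z.2 g := by
  obtain ⟨x, y⟩ := z
  have h (a b : IsoCls C) : coeff₂ (x, y) (Finsupp.single (a, b) (coeff a f * coeff b g)) =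
      (if a = x then coeff a f else 0) * (if b = y then coeff b g else 0) := by
    refine (Finsupp.single_apply ..).trans ?_
    by_cases ha : a = x <;> by_cases hb : b = y <;> simp [ha, hb]
  have aux (f : Hall C) (x : IsoCls C) :
      ∑ a ∈ Finsupp.support f, (if a = x then coeff a f else 0) = coeff x f := by
    rw [Finset.sum_ite_eq']
    split_ifs with hx
    · rfl
    · exact (Finsupp.notMem_support_iff.1 hx).symm
  refine (map_sum (coeff₂ (x, y)) _ _).trans ?_
  refine (Finset.sum_congr rfl fun a _ => (map_sum (coeff₂ (x, y)) _ _).trans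
    (Finset.sum_congr rfl fun b _ => h a b)).trans ?_
  rw [← Finset.sum_mul_sum, aux, aux]

lemma coeff₂_hmul2 (v : ℂ) (q : ℕ) (f g : Hall2 C) (S : Finset (IsoCls C × IsoCls C))
    (hf : ∀ m ∉ S, coeff₂ m f = 0) (hg : ∀ m ∉ S, coeff₂ m g = 0) (z : IsoCls C × IsoCls C) :
    coeff₂ z (hmul2 v q f g) = ∑ m ∈ S, ∑ n ∈ S, coeff₂ m f * coeff₂ n g *
      (v ^ euler q m.2.out n.1.out * v ^ euler q n.1.out m.2.out) *
        (coeff z.1 (mulBasis v q m.1 n.1) * coeff z.2 (mulBasis v q m.2 n.2)) := by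
  refine (map_sum (coeff₂ z) _ _).trans ?_
  refine (Finset.sum_congr rfl fun m _ => (map_sum (coeff₂ z) _ _).trans
    (Finset.sum_congr rfl fun n _ => (map_smul (coeff₂ z) _ _).trans
      (congrArg _ (coeff₂_combine _ _ z)))).trans ?_
  refine (Finset.sum_congr rfl fun m _ => Finset.sum_subset (s₂ := S) (fun n hn => ?_)
    fun n _ hn => ?_).trans (Finset.sum_subset (fun m hm => ?_) fun m _ hm => ?_)
  · by_contra h
    exact Finsupp.mem_support_iff.1 hn (hg n h)
  · rw [Finsupp.notMem_support_iff.1 hn, mul_zero, zero_mul, zero_smul]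
  · by_contra h
    exact Finsupp.mem_support_iff.1 hm (hf m h)
  · refine Finset.sum_eq_zero fun n _ => ?_
    rw [Finsupp.notMem_support_iff.1 hm, zero_mul, zero_mul, zero_smul]

end Coefficients

end

section

open Abelian

lemma zpow_euler_cross {F : Type} [Field F] [Fintype F] [CategoryTheory.Linear F C]
    [∀ X Y : C, Finite (X ⟶ Y)] [∀ X Y : C, Finite (Ext.{max u v} X Y 1)]
    (hhered : ∀ X Y : C, Subsingleton (Ext.{max u v} X Y 2)) {q : ℕ} (hF : Fintype.card F = q)
    {v : ℂ} (hv : v ^ 2 = (q : ℂ)) {M N X Y A B K D : C} (p₁ : P M A B) (p₂ : P N K D)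
    (p₃ : P X A K) (p₄ : P Y B D) :
    v ^ euler q M N * v ^ euler q X Y *
      (Nat.card (Ext.{max u v} A D 1) * (Nat.card (A ⟶ D) : ℂ)⁻¹) =
    v ^ euler q A B * v ^ euler q K D * (v ^ euler q B K * v ^ euler q K B) *
      (v ^ euler q A K * v ^ euler q B D) := by
  subst hF
  have hq : (Fintype.card F : ℂ) ≠ 0 := Nat.cast_ne_zero.2 Fintype.card_ne_zero
  have hv₀ : v ≠ 0 := by
    rintro rfl
    exact hq (by rw [← hv]; simp)
  have h : (Nat.card (Ext.{max u v} A D 1) * (Nat.card (A ⟶ D) : ℂ)⁻¹) =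
      v ^ (-(2 * euler (Fintype.card F) A D)) := by
    rw [zpow_neg, zpow_mul, zpow_ofNat, hv, zpow_euler, mul_inv, inv_inv, mul_comm]
  rw [h, ← zpow_add₀ hv₀, ← zpow_add₀ hv₀, ← zpow_add₀ hv₀, ← zpow_add₀ hv₀, ← zpow_add₀ hv₀,
    ← zpow_add₀ hv₀, ← zpow_add₀ hv₀]
  congr 1
  have e₁ := p₁.2.euler_left (F := F) hhered N
  have e₂ := p₂.2.euler_right (F := F) hhered A
  have e₃ := p₂.2.euler_right (F := F) hhered B
  have e₄ := p₃.2.euler_left (F := F) hhered Y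
  have e₅ := p₄.2.euler_right (F := F) hhered A
  have e₆ := p₄.2.euler_right (F := F) hhered K
  omega

lemma hallNum_eq_zero [∀ X Y : C, Finite (X ⟶ Y)] [∀ X : C, Finite (Subobject X)] {L M N : C}
    [IsEmpty (P L M N)] : hallNum L M N = 0 := by
  have h := card_P L M N
  rw [Nat.card_of_isEmpty] at h
  have := aut_ne_zero M
  have := aut_ne_zero N
  simp_all

lemma nonempty_P_of_hallNum_ne_zero [∀ X Y : C, Finite (X ⟶ Y)] [∀ X : C, Finite (Subobject X)]
    {L M N : C} (h : hallNum L M N ≠ 0) : Nonempty (P L M N) := by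
  by_contra h'
  have := not_nonempty_iff.1 h'
  exact h hallNum_eq_zero

lemma structure_constant_eq {va vx e w₁ w₂ w₃ w₄ w₅ w₆ h₁ h₂ h₃ h₄ aa ab ax ay A B K D : ℂ}
    (haa : aa ≠ 0) (hab : ab ≠ 0) (hax : ax ≠ 0) (hay : ay ≠ 0) (hA : A ≠ 0) (hB : B ≠ 0)
    (hK : K ≠ 0) (hD : D ≠ 0) (k : va * vx * e = w₁ * w₂ * (w₃ * w₄) * (w₅ * w₆)) :
    va * vx * (aa * ab * ax * ay)⁻¹ * (ax * ay) * (A⁻¹ * (B⁻¹ * (K⁻¹ * (D⁻¹ *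
      (e * (h₁ * A * B * (h₃ * A * K)) * (h₂ * K * D * (h₄ * B * D))))))) =
    w₁ * (h₁ * A * B) / aa * (w₂ * (h₂ * K * D) / ab) * (w₃ * w₄) * (w₅ * h₃ * (w₆ * h₄)) := by
  field_simp
  linear_combination (h₁ * h₂ * h₃ * h₄) * k

end

/-- The comultiplication is an algebra homomorphism for the twisted multiplication. -/
theorem delta_hmul (q : ℕ) (hq : IsPrimePow q)
    (F : Type) [Field F] [Fintype F] (hF : Fintype.card F = q)
    [CategoryTheory.Linear F C] [EssentiallySmall.{v} C]
    (v : ℂ) (hv : v ^ 2 = (q : ℂ))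
    -- finitary: all Hom-spaces and Ext¹-groups are finite
    (hfinHom : ∀ X Y : C, Finite (X ⟶ Y))
    (hfinExt : ∀ X Y : C, Finite (Abelian.Ext.{max u v} X Y 1))
    -- every object has finitely many subobjects
    (hfinSub : ∀ X : C, Finite (Subobject X))
    -- hereditary: Ext² vanishes
    (hhered : ∀ X Y : C, Subsingleton (Abelian.Ext.{max u v} X Y 2))
    (M N : C) :
    delta v q (hmul v q (u M) (u N)) = hmul2 v q (delta v q (u M)) (delta v q (u N)) := by
  rw [hmul_u, delta_u, delta_u]
  generalize cls M = a
  generalize cls N = b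
  refine hall2_ext fun ⟨x, y⟩ => ?_
  have fm (a b : IsoCls C) : {l : IsoCls C | hallNum l.out a.out b.out ≠ 0}.Finite :=
    (finite_setOf_nonempty_P a.out b.out).subset fun l hl => nonempty_P_of_hallNum_ne_zero hl
  have fd (l : IsoCls C) :
      {z : IsoCls C × IsoCls C | hallNum l.out z.1.out z.2.out ≠ 0}.Finite :=
    (finite_setOf_nonempty_P_left l.out).subset fun z hz => nonempty_P_of_hallNum_ne_zero hz
  obtain ⟨T, hT⟩ : ∃ T : Finset (IsoCls C),
      (∀ E : IsoCls C, Nonempty (P E.out a.out b.out) → E ∈ T) ∧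
      (∀ A B : IsoCls C, Nonempty (P a.out A.out B.out) → A ∈ T ∧ B ∈ T) ∧
      (∀ A B : IsoCls C, Nonempty (P b.out A.out B.out) → A ∈ T ∧ B ∈ T) := by
    have s₀ := finite_setOf_nonempty_P a.out b.out
    have s₁ := finite_setOf_nonempty_P_left a.out
    have s₂ := finite_setOf_nonempty_P_left b.out
    refine ⟨(s₀.union (((s₁.image Prod.fst).union (s₁.image Prod.snd)).union
      ((s₂.image Prod.fst).union (s₂.image Prod.snd)))).toFinset, fun E h => ?_, fun A B h => ?_,
      fun A B h => ?_⟩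
    · rw [Set.Finite.mem_toFinset]
      exact Or.inl h
    · rw [Set.Finite.mem_toFinset, Set.Finite.mem_toFinset]
      exact ⟨Or.inr (Or.inl (Or.inl ⟨(A, B), h, rfl⟩)), Or.inr (Or.inl (Or.inr ⟨(A, B), h, rfl⟩))⟩
    · rw [Set.Finite.mem_toFinset, Set.Finite.mem_toFinset]
      exact ⟨Or.inr (Or.inr (Or.inl ⟨(A, B), h, rfl⟩)), Or.inr (Or.inr (Or.inr ⟨(A, B), h, rfl⟩))⟩
  obtain ⟨hE, hM, hN⟩ := hT
  have ha (X : C) : (aut X : ℂ) ≠ 0 := Nat.cast_ne_zero.2 (aut_ne_zero X)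
  have hP (L M N : C) : (Nat.card (P L M N) : ℂ) = hallNum L M N * aut M * aut N := by
    rw [card_P]; push_cast; rfl
  have hg := green_sum hhered a.out b.out x.out y.out T
    (fun E h => not_nonempty_iff.1 fun h' => h (hE E h'))
    (fun A h B => not_nonempty_iff.1 fun h' => h (hM A B h').1)
    (fun A B h => not_nonempty_iff.1 fun h' => h (hM A B h').2)
    (fun A h B => not_nonempty_iff.1 fun h' => h (hN A B h').1)
    (fun A B h => not_nonempty_iff.1 fun h' => h (hN A B h').2)
  rw [coeff₂_delta v q _ T fun l hl => ?_, coeff₂_hmul2 v q _ _ (T ×ˢ T) (fun m hm => ?_)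
    (fun m hm => ?_)]
  · calc
      _ = v ^ euler q a.out b.out * v ^ euler q x.out y.out *
            ((aut a.out : ℂ) * aut b.out * aut x.out * aut y.out)⁻¹ * (aut x.out * aut y.out) *
          ∑ E ∈ T, (aut E.out : ℂ)⁻¹ *
            (Nat.card (P E.out a.out b.out) * Nat.card (P E.out x.out y.out)) := by
        rw [Finset.mul_sum]
        refine Finset.sum_congr rfl fun E _ => ?_
        rw [coeff_mulBasis _ _ _ _ _ (fm _ _), coeff₂_deltaBasis _ _ _ _ (fd _), hP, hP]
        have := ha a.out
        have := ha b.out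
        have := ha x.out
        have := ha y.out
        have := ha E.out
        field_simp
      _ = _ := by
        rw [hg, Finset.sum_product, Finset.mul_sum]
        refine Finset.sum_congr rfl fun A _ => ?_
        rw [Finset.mul_sum, Finset.mul_sum]
        refine Finset.sum_congr rfl fun B _ => ?_
        rw [Finset.sum_product, Finset.mul_sum, Finset.mul_sum, Finset.mul_sum]
        refine Finset.sum_congr rfl fun K _ => ?_
        rw [Finset.mul_sum, Finset.mul_sum, Finset.mul_sum, Finset.mul_sum]
        refine Finset.sum_congr rfl fun D _ => ?_
        rw [coeff_mulBasis _ _ _ _ _ (fm _ _), coeff_mulBasis _ _ _ _ _ (fm _ _),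
          coeff₂_deltaBasis _ _ _ _ (fd _), coeff₂_deltaBasis _ _ _ _ (fd _)]
        dsimp only
        rcases isEmpty_or_nonempty (P a.out A.out B.out) with _ | ⟨⟨p₁⟩⟩
        · simp [hallNum_eq_zero]
        rcases isEmpty_or_nonempty (P b.out K.out D.out) with _ | ⟨⟨p₂⟩⟩
        · simp [hallNum_eq_zero]
        rcases isEmpty_or_nonempty (P x.out A.out K.out) with _ | ⟨⟨p₃⟩⟩
        · simp [hallNum_eq_zero]
        rcases isEmpty_or_nonempty (P y.out B.out D.out) with _ | ⟨⟨p₄⟩⟩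
        · simp [hallNum_eq_zero]
        have k := zpow_euler_cross hhered hF hv p₁ p₂ p₃ p₄
        rw [hP, hP, hP, hP]
        exact structure_constant_eq (ha _) (ha _) (ha _) (ha _) (ha _) (ha _) (ha _) (ha _) k
  · rw [coeff₂_deltaBasis _ _ _ _ (fd _)]
    have := not_nonempty_iff.1 fun h => hm (Finset.mem_product.2 (hM m.1 m.2 h))
    simp [hallNum_eq_zero]
  · rw [coeff₂_deltaBasis _ _ _ _ (fd _)]
    have := not_nonempty_iff.1 fun h => hm (Finset.mem_product.2 (hN m.1 m.2 h))
    simp [hallNum_eq_zero]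
  · rw [coeff_mulBasis _ _ _ _ _ (fm _ _)]
    have := not_nonempty_iff.1 fun h => hl (hE l h)
    simp [hallNum_eq_zero]

end HallAlg
end

section
/- Riedtmann–Peng formula: for all objects M, N, L of 𝒜, g^L_{MN} · |Hom_𝒜(M,N)| · a_M · a_N = |Ext¹_𝒜(M,N)_L| · a_L, where Ext¹_𝒜(M,N)_L ⊆ Ext¹_𝒜(M,N) is the subset of those extension classes that are represented by a short exact sequence 0 → N → E → M → 0 with E ≅ L. -/
/-!
Riedtmann–Peng formula: in a finitary abelian category `𝒜` (over a finite field,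
with finitely many subobjects of each object), for all objects `M N L`,
  g^L_{MN} · |Hom(M,N)| · a_M · a_N = |Ext¹(M,N)_L| · a_L,
where `Ext¹(M,N)_L ⊆ Ext¹(M,N)` consists of the extension classes represented by
a short exact sequence `0 → N → E → M → 0` with `E ≅ L`.
-/

open CategoryTheory CategoryTheory.Limits

universe v u

namespace RiedtmannPeng

variable (C : Type u) [Category.{v} C] [Abelian C]

/-- Ext groups exist (with the standard construction of the derived category). -/
instance hasExtStandard : HasExt.{max u v} C :=
  letI := HasDerivedCategory.standard C
  hasExt_of_hasDerivedCategory C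

variable {C}

/-- `a_X = |Aut X|`, the number of automorphisms of `X`. -/
noncomputable def aut (X : C) : ℕ := Nat.card (Aut X)

/-- The Hall number `g^L_{MN}`: the number of subobjects `L'` of `L` with
`L' ≅ N` and `L/L' ≅ M`. -/
noncomputable def hallNum (L M N : C) : ℕ :=
  Nat.card {L' : Subobject L //
    Nonempty ((L' : C) ≅ N) ∧ Nonempty (cokernel L'.arrow ≅ M)}

/-- `Ext¹(M,N)_L`: the set of extension classes in `Ext¹(M,N)` represented by a
short exact sequence `0 → N → E → M → 0` whose middle term `E` is isomorphic
to `L`. -/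
def extSetWithMiddle (M N L : C) : Set (Abelian.Ext.{max u v} M N 1) :=
  {e | ∃ (E : C) (i : N ⟶ E) (p : E ⟶ M) (w : i ≫ p = 0)
    (h : (ShortComplex.mk i p w).ShortExact), h.extClass = e ∧ Nonempty (E ≅ L)}

/-- If all fibres of `f : α → β` are in bijection with `γ`, then `α` is in bijection
with `β × γ`. -/
lemma nonempty_equiv_prod_of_fiber_equiv {α β γ : Type*} (f : α → β)
    (h : ∀ b, Nonempty ({a // f a = b} ≃ γ)) : Nonempty (α ≃ β × γ) :=
  ⟨(Equiv.sigmaFiberEquiv f).symm.trans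
    ((Equiv.sigmaCongrRight fun b ↦ (h b).some).trans (Equiv.sigmaEquivProd β γ))⟩

/-- The short exact sequences `0 ⟶ N ⟶ L ⟶ M ⟶ 0`. -/
@[ext]
structure SES (N L M : C) where
  /-- The inclusion. -/
  i : N ⟶ L
  /-- The projection. -/
  p : L ⟶ M
  zero : i ≫ p = 0
  shortExact : (ShortComplex.mk i p zero).ShortExact

namespace SES

attribute [simp] zero

instance {N L M : C} (w : SES N L M) : Mono w.i := w.shortExact.mono_f

instance {N L M : C} (w : SES N L M) : Epi w.p := w.shortExact.epi_g

/-- The class of a short exact sequence in `Ext¹`. -/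
noncomputable def extClass {N L M : C} (w : SES N L M) : Abelian.Ext.{max u v} M N 1 :=
  w.shortExact.extClass

/-- Transport of a short exact sequence along isomorphisms of its three objects. -/
@[simps]
def ofIso {N L M N' L' M' : C} (w : SES N L M) (a : N ≅ N') (e : L ≅ L') (b : M ≅ M') :
    SES N' L' M' where
  i := a.inv ≫ w.i ≫ e.hom
  p := e.inv ≫ w.p ≫ b.hom
  zero := by simp [reassoc_of% w.zero]
  shortExact := ShortComplex.shortExact_of_iso
    (S₁ := ShortComplex.mk w.i w.p w.zero) (ShortComplex.isoMk a e b) w.shortExact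

lemma exists_lift {X N L M : C} (w : SES N L M) (f : X ⟶ L) (hf : f ≫ w.p = 0) :
    ∃ g : X ⟶ N, g ≫ w.i = f :=
  have : Mono (ShortComplex.mk w.i w.p w.zero).f := w.shortExact.mono_f
  ⟨w.shortExact.exact.lift f hf, w.shortExact.exact.lift_f f hf⟩

lemma exists_desc {X N L M : C} (w : SES N L M) (f : L ⟶ X) (hf : w.i ≫ f = 0) :
    ∃ g : M ⟶ X, w.p ≫ g = f :=
  have : Epi (ShortComplex.mk w.i w.p w.zero).g := w.shortExact.epi_g
  ⟨w.shortExact.exact.desc f hf, w.shortExact.exact.g_desc f hf⟩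

/-- A morphism of short exact sequences that is the identity on the outer terms is an
isomorphism. -/
lemma isIso_of_comm {N L L' M : C} (w : SES N L M) (w' : SES N L' M) (φ : L ⟶ L')
    (hi : w.i ≫ φ = w'.i) (hp : φ ≫ w'.p = w.p) : IsIso φ := by
  let f : ShortComplex.mk w.i w.p w.zero ⟶ ShortComplex.mk w'.i w'.p w'.zero :=
    { τ₁ := 𝟙 N, τ₂ := φ, τ₃ := 𝟙 M, comm₁₂ := by simp [hi], comm₂₃ := by simp [hp] }
  have h₁ : IsIso f.τ₁ := inferInstanceAs (IsIso (𝟙 N))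
  have h₃ : IsIso f.τ₃ := inferInstanceAs (IsIso (𝟙 M))
  exact ShortComplex.isIso₂_of_shortExact_of_isIso₁₃ f w.shortExact w'.shortExact

/-- Equivalent short exact sequences have the same class. -/
lemma extClass_eq_of_comm {N L L' M : C} (w : SES N L M) (w' : SES N L' M) (φ : L ⟶ L')
    (hi : w.i ≫ φ = w'.i) (hp : φ ≫ w'.p = w.p) : w.extClass = w'.extClass := by
  let f : ShortComplex.mk w.i w.p w.zero ⟶ ShortComplex.mk w'.i w'.p w'.zero :=
    { τ₁ := 𝟙 N, τ₂ := φ, τ₃ := 𝟙 M, comm₁₂ := by simp [hi], comm₂₃ := by simp [hp] }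
  simpa [f, extClass] using
    ShortComplex.ShortExact.extClass_naturality w.shortExact w'.shortExact f

/-- Short exact sequences with the same class are equivalent. -/
lemma exists_iso_of_extClass_eq {N L L' M : C} (w : SES N L M) (w' : SES N L' M)
    (h : w.extClass = w'.extClass) :
    ∃ φ : L ≅ L', w.i ≫ φ.hom = w'.i ∧ φ.hom ≫ w'.p = w.p := by
  obtain ⟨x, hx⟩ := Abelian.Ext.covariant_sequence_exact₃ L w'.shortExact
    (Abelian.Ext.mk₀ w.p) (zero_add 1) (by
      change (Abelian.Ext.mk₀ w.p).comp w'.extClass _ = 0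
      rw [← h]
      exact w.shortExact.comp_extClass)
  obtain ⟨φ, rfl⟩ := (Abelian.Ext.mk₀_bijective _ _).2 x
  rw [Abelian.Ext.mk₀_comp_mk₀] at hx
  replace hx : φ ≫ w'.p = w.p := (Abelian.Ext.mk₀_bijective _ _).1 hx
  obtain ⟨a, ha⟩ := w'.exists_lift (w.i ≫ φ) (by simp [hx])
  let f : ShortComplex.mk w.i w.p w.zero ⟶ ShortComplex.mk w'.i w'.p w'.zero :=
    { τ₁ := a, τ₂ := φ, τ₃ := 𝟙 M, comm₁₂ := by simp [ha], comm₂₃ := by simp [hx] }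
  have nat : w.extClass.comp (Abelian.Ext.mk₀ a) (add_zero 1) = w.extClass := by
    have := ShortComplex.ShortExact.extClass_naturality w.shortExact w'.shortExact f
    simp only [f, Abelian.Ext.mk₀_id_comp] at this
    exact this.trans h.symm
  obtain ⟨y, hy⟩ := Abelian.Ext.contravariant_sequence_exact₁ w.shortExact N
    (Abelian.Ext.mk₀ (a - 𝟙 N)) (add_zero 1) (by
      change w.extClass.comp _ _ = 0
      rw [sub_eq_add_neg, Abelian.Ext.mk₀_add, Abelian.Ext.mk₀_neg, Abelian.Ext.comp_add,
        Abelian.Ext.comp_neg, nat, Abelian.Ext.comp_mk₀_id, add_neg_cancel])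
  obtain ⟨b, rfl⟩ := (Abelian.Ext.mk₀_bijective _ _).2 y
  rw [Abelian.Ext.mk₀_comp_mk₀] at hy
  replace hy : w.i ≫ b = a - 𝟙 N := (Abelian.Ext.mk₀_bijective _ _).1 hy
  have hi : w.i ≫ (φ - b ≫ w'.i) = w'.i := by
    rw [Preadditive.comp_sub, reassoc_of% hy, ← ha]
    simp
  have hp : (φ - b ≫ w'.i) ≫ w'.p = w.p := by simp [hx]
  have := isIso_of_comm w w' _ hi hp
  exact ⟨asIso (φ - b ≫ w'.i), hi, hp⟩

/-- The automorphism `1 + p f i` of the middle term attached to `f : M ⟶ N`. -/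
@[simps]
def shear {N L M : C} (w : SES N L M) (f : M ⟶ N) : L ≅ L where
  hom := 𝟙 L + w.p ≫ f ≫ w.i
  inv := 𝟙 L - w.p ≫ f ≫ w.i
  hom_inv_id := by simp [reassoc_of% w.zero]
  inv_hom_id := by simp [reassoc_of% w.zero]

lemma ofIso_shear {N L L' M : C} (w : SES N L M) (f : M ⟶ N) (φ : L ≅ L') :
    w.ofIso (Iso.refl N) (w.shear f ≪≫ φ) (Iso.refl M) =
      w.ofIso (Iso.refl N) φ (Iso.refl M) := by
  ext
  · simp [reassoc_of% w.zero]
  · simp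

/-- The equivalences between two equivalent short exact sequences form a torsor under
`Hom(M, N)`. -/
lemma nonempty_fiber_equiv_hom {N L L' M : C} (w : SES N L M) (φ₀ : L ≅ L') :
    Nonempty ({φ : L ≅ L' // w.ofIso (Iso.refl N) φ (Iso.refl M) =
      w.ofIso (Iso.refl N) φ₀ (Iso.refl M)} ≃ (M ⟶ N)) := by
  refine ⟨(Equiv.ofBijective (fun f ↦ ⟨w.shear f ≪≫ φ₀, w.ofIso_shear f φ₀⟩) ⟨?_, ?_⟩).symm⟩
  · intro f g hfg
    have := congrArg (fun x ↦ x.1.hom) hfg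
    simpa [cancel_epi, cancel_mono] using this
  · rintro ⟨φ, hφ⟩
    have hi : w.i ≫ φ.hom = w.i ≫ φ₀.hom := by simpa using congrArg SES.i hφ
    have hp : φ.inv ≫ w.p = φ₀.inv ≫ w.p := by simpa using congrArg SES.p hφ
    obtain ⟨g, hg⟩ := w.exists_desc (φ.hom ≫ φ₀.inv - 𝟙 L) (by simp [reassoc_of% hi])
    obtain ⟨f, hf⟩ := w.exists_lift g (by
      rw [← cancel_epi w.p, reassoc_of% hg]
      simp [← hp])
    refine ⟨f, Subtype.ext (Iso.ext ?_)⟩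
    simp [hf, hg]

/-- The short exact sequences with middle term `L` in a given class form an orbit under `Aut L`
with stabilizers in bijection with `Hom(M, N)`. -/
lemma nonempty_iso_equiv {N L M : C} (w₀ : SES N L M) :
    Nonempty ((L ≅ L) ≃ {w : SES N L M // w.extClass = w₀.extClass} × (M ⟶ N)) := by
  refine nonempty_equiv_prod_of_fiber_equiv (fun φ : L ≅ L ↦
    ⟨w₀.ofIso (Iso.refl N) φ (Iso.refl M),
      (extClass_eq_of_comm _ _ φ.hom (by simp) (by simp)).symm⟩) ?_
  rintro ⟨w, hw⟩
  obtain ⟨φ₀, hi, hp⟩ := exists_iso_of_extClass_eq w₀ w hw.symm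
  have : w = w₀.ofIso (Iso.refl N) φ₀ (Iso.refl M) := by
    ext <;> simp [hi, ← hp]
  subst this
  simpa only [Subtype.mk.injEq] using w₀.nonempty_fiber_equiv_hom φ₀

lemma extClass_mem {N L M : C} (w : SES N L M) : w.extClass ∈ extSetWithMiddle M N L :=
  ⟨L, w.i, w.p, w.zero, w.shortExact, rfl, ⟨Iso.refl L⟩⟩

lemma exists_extClass_eq {N L M : C} {e : Abelian.Ext.{max u v} M N 1}
    (he : e ∈ extSetWithMiddle M N L) : ∃ w : SES N L M, w.extClass = e := by
  obtain ⟨E, i, p, zero, h, rfl, ⟨φ⟩⟩ := he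
  let w : SES N E M := ⟨i, p, zero, h⟩
  exact ⟨w.ofIso (Iso.refl N) φ (Iso.refl M),
    (extClass_eq_of_comm w _ φ.hom (by simp) (by simp)).symm⟩

lemma mk_eq_mk_iff {N L M : C} (w w' : SES N L M) :
    Subobject.mk w'.i = Subobject.mk w.i ↔
      ∃ (a : N ≅ N) (b : M ≅ M), w' = w.ofIso a (Iso.refl L) b := by
  constructor
  · intro h
    let a : N ≅ N := Subobject.isoOfMkEqMk _ _ h
    have ha : w'.i = a.hom ≫ w.i := by simp [a]
    have ha' : a.inv ≫ w'.i = w.i := by simp [ha]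
    obtain ⟨b, hb⟩ := w.exists_desc w'.p (by simp [← ha'])
    obtain ⟨c, hc⟩ := w'.exists_desc w.p (by simp [ha])
    refine ⟨a.symm, ⟨b, c, ?_, ?_⟩, ?_⟩
    · rw [← cancel_epi w.p, reassoc_of% hb, hc, Category.comp_id]
    · rw [← cancel_epi w'.p, reassoc_of% hc, hb, Category.comp_id]
    · ext <;> simp [ha, hb]
  · rintro ⟨a, b, rfl⟩
    exact Subobject.mk_eq_mk_of_comm _ _ a.symm (by simp)

/-- The cokernel of the subobject defined by a short exact sequence is its third term. -/
noncomputable def cokernelIso {N L M : C} (w : SES N L M) :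
    cokernel (Subobject.mk w.i).arrow ≅ M :=
  cokernelIsoOfEq (Subobject.underlyingIso_hom_comp_eq_mk w.i).symm ≪≫ cokernelEpiComp _ _ ≪≫
    (cokernelIsCokernel w.i).coconePointUniqueUpToIso w.shortExact.gIsCokernel

/-- `Aut N × Aut M` acts freely on the short exact sequences, the orbits being the subobjects
counted by the Hall number. -/
lemma card_eq (N L M : C) : Nat.card (SES N L M) = hallNum L M N * (aut N * aut M) := by
  rw [hallNum, aut, aut, ← Nat.card_prod, ← Nat.card_prod]
  refine Nat.card_congr (nonempty_equiv_prod_of_fiber_equiv (fun w ↦ ⟨Subobject.mk w.i,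
    ⟨Subobject.underlyingIso w.i⟩, ⟨w.cokernelIso⟩⟩) ?_).some
  rintro ⟨S, ⟨a⟩, ⟨b⟩⟩
  let w : SES N L M := SES.ofIso
    ⟨S.arrow, cokernel.π S.arrow, cokernel.condition _,
      { exact := ShortComplex.exact_of_g_is_cokernel _ (cokernelIsCokernel _)
        mono_f := inferInstanceAs (Mono S.arrow)
        epi_g := inferInstanceAs (Epi (cokernel.π S.arrow)) }⟩ a (Iso.refl L) b
  have hw : S = Subobject.mk w.i := by
    conv_lhs => rw [← Subobject.mk_arrow S]
    exact Subobject.mk_eq_mk_of_comm _ _ a (by simp [w])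
  simp only [Subtype.mk.injEq, hw, mk_eq_mk_iff]
  refine ⟨(Equiv.ofBijective (fun x : (N ≅ N) × (M ≅ M) ↦
    ⟨w.ofIso x.1 (Iso.refl L) x.2, x.1, x.2, rfl⟩) ⟨?_, ?_⟩).symm⟩
  · rintro ⟨a₁, b₁⟩ ⟨a₂, b₂⟩ h
    have h := congrArg Subtype.val h
    have hi : a₁.symm = a₂.symm := Iso.ext (by
      simpa [cancel_mono] using congrArg SES.i h)
    have hp : b₁ = b₂ := Iso.ext (by
      simpa [cancel_epi] using congrArg SES.p h)
    rw [← Iso.symm_symm_eq a₁, hi, hp]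
    rfl
  · rintro ⟨_, a₁, b₁, rfl⟩
    exact ⟨⟨a₁, b₁⟩, rfl⟩

/-- Counting the short exact sequences by their classes in `Ext¹`. -/
lemma card_mul_card_hom (N L M : C) :
    Nat.card (SES N L M) * Nat.card (M ⟶ N) = Nat.card (extSetWithMiddle M N L) * aut L := by
  rw [aut, ← Nat.card_prod, ← Nat.card_prod]
  refine Nat.card_congr (nonempty_equiv_prod_of_fiber_equiv
    (fun x : SES N L M × (M ⟶ N) ↦ ⟨x.1.extClass, x.1.extClass_mem⟩) ?_).some
  rintro ⟨e, he⟩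
  obtain ⟨w₀, rfl⟩ := exists_extClass_eq he
  simp only [Subtype.mk.injEq]
  exact ⟨(Equiv.prodSubtypeFstEquivSubtypeProd
    (p := fun w : SES N L M ↦ w.extClass = w₀.extClass)).trans w₀.nonempty_iso_equiv.some.symm⟩

end SES

/-- The Riedtmann–Peng formula. -/
theorem riedtmann_peng (q : ℕ) (hq : IsPrimePow q)
    (F : Type) [Field F] [Fintype F] (hF : Fintype.card F = q)
    [CategoryTheory.Linear F C] [EssentiallySmall.{v} C]
    -- finitary: all Hom-spaces and Ext¹-groups are finite
    (hfinHom : ∀ X Y : C, Finite (X ⟶ Y))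
    (hfinExt : ∀ X Y : C, Finite (Abelian.Ext.{max u v} X Y 1))
    -- every object has finitely many subobjects
    (hfinSub : ∀ X : C, Finite (Subobject X))
    (M N L : C) :
    hallNum L M N * Nat.card (M ⟶ N) * aut M * aut N
      = Nat.card (extSetWithMiddle M N L) * aut L := by
  rw [mul_right_comm _ (aut M), mul_right_comm, ← SES.card_mul_card_hom, SES.card_eq]
  ring

end RiedtmannPeng
end
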